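/- arXiv:math/0210123 — 2 statements merged into one kernel-verified Lean document; each statement's English description precedes it below -/
import Mathlib

section
/- Let N and T be cocommutative Hopf algebras over a field k with N a T-module bialgebra, and let A be a commutative k-algebra with trivial action. Let f be a Sweedler 2-cocycle on N whose class is T-stable, with stability witness g: T⊗N → A. Then (t⊗t')(n) ↦ ∑ g(t'_(1)⊗n_(1)) g^{-1}(t_(1)t'_(2)⊗n_(2)) g(t_(2)⊗t'_(3)(n_(3))) is a measuring 2-cocycle; for two stability witnesses g and g' of the same f, the two resulting measuring 2-cocycles differ by a measuring 2-coboundary; and if f is a Sweedler 2-coboundary on N then the resulting measuring 2-cocycle is a measuring 2-coboundary. Hence this assignment defines a group homomorphism d: H²(N,A)^T → H²_meas(T,Hom(N,A)). -/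
open TensorProduct

namespace SmashPaper

variable (k : Type) [Field k]

section Conv

variable {k : Type} [Field k] {C A : Type} [AddCommGroup C] [Module k C] [Coalgebra k C]
  [CommRing A] [Algebra k A]

/-- Convolution product on linear maps from a coalgebra to an algebra. -/
noncomputable def conv (f g : C →ₗ[k] A) : C →ₗ[k] A :=
  LinearMap.mul' k A ∘ₗ TensorProduct.map f g ∘ₗ Coalgebra.comul

/-- Convolution unit. -/
noncomputable def convOne (C A : Type) [AddCommGroup C] [Module k C] [Coalgebra k C]
    [CommRing A] [Algebra k A] : C →ₗ[k] A :=
  Algebra.linearMap k A ∘ₗ Coalgebra.counit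

def IsConvInv (f g : C →ₗ[k] A) : Prop :=
  conv f g = convOne C A ∧ conv g f = convOne C A

def IsConvInvertible (f : C →ₗ[k] A) : Prop := ∃ g, IsConvInv f g

end Conv

/-- Cocommutativity of a coalgebra. -/
def IsCocomm (C : Type) [AddCommGroup C] [Module k C] [Coalgebra k C] : Prop :=
  (TensorProduct.comm k C C).toLinearMap ∘ₗ Coalgebra.comul
    = (Coalgebra.comul : C →ₗ[k] C ⊗[k] C)

section Drop

variable {k : Type} [Field k] (C D : Type) [AddCommGroup C] [Module k C]
  [AddCommGroup D] [Module k D]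

/-- `c ⊗ d ↦ ε(c) d`. -/
noncomputable def dropL [Coalgebra k C] : C ⊗[k] D →ₗ[k] D :=
  (TensorProduct.lid k D).toLinearMap ∘ₗ LinearMap.rTensor D (Coalgebra.counit (R := k))

/-- `c ⊗ d ↦ ε(d) c`. -/
noncomputable def dropR [Coalgebra k D] : C ⊗[k] D →ₗ[k] C :=
  (TensorProduct.rid k C).toLinearMap ∘ₗ LinearMap.lTensor C (Coalgebra.counit (R := k))

end Drop

section Sweedler

variable {k : Type} [Field k] (H A : Type) [Ring H] [Bialgebra k H]
  [CommRing A] [Algebra k A]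

variable {H A}

/-- Normalization for 1-cochains. -/
def Normalized1 (t : H →ₗ[k] A) : Prop := t 1 = 1

/-- Normalization for 2-cochains: trivial whenever an argument is a scalar. -/
def Normalized2 (f : H ⊗[k] H →ₗ[k] A) : Prop :=
  ∀ x : H, f (1 ⊗ₜ[k] x) = algebraMap k A (Coalgebra.counit x)
    ∧ f (x ⊗ₜ[k] 1) = algebraMap k A (Coalgebra.counit x)

/-- Normalization for 3-cochains. -/
def Normalized3 (f : (H ⊗[k] H) ⊗[k] H →ₗ[k] A) : Prop :=
  ∀ x y : H,
    f ((1 ⊗ₜ[k] x) ⊗ₜ[k] y) = algebraMap k A (Coalgebra.counit x * Coalgebra.counit y)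
    ∧ f ((x ⊗ₜ[k] 1) ⊗ₜ[k] y) = algebraMap k A (Coalgebra.counit x * Coalgebra.counit y)
    ∧ f ((x ⊗ₜ[k] y) ⊗ₜ[k] 1) = algebraMap k A (Coalgebra.counit x * Coalgebra.counit y)

/-- `∑ f(x₍₁₎ ⊗ y₍₁₎) f(x₍₂₎y₍₂₎ ⊗ z)` as a linear map on `(H ⊗ H) ⊗ H`. -/
noncomputable def cocycle2LHS (f : H ⊗[k] H →ₗ[k] A) : (H ⊗[k] H) ⊗[k] H →ₗ[k] A :=
  conv (f ∘ₗ dropR (H ⊗[k] H) H) (f ∘ₗ LinearMap.rTensor H (LinearMap.mul' k H))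

/-- `∑ f(y₍₁₎ ⊗ z₍₁₎) f(x ⊗ y₍₂₎z₍₂₎)` as a linear map on `(H ⊗ H) ⊗ H`. -/
noncomputable def cocycle2RHS (f : H ⊗[k] H →ₗ[k] A) : (H ⊗[k] H) ⊗[k] H →ₗ[k] A :=
  conv (f ∘ₗ dropL H (H ⊗[k] H) ∘ₗ (TensorProduct.assoc k H H H).toLinearMap)
       (f ∘ₗ LinearMap.lTensor H (LinearMap.mul' k H) ∘ₗ (TensorProduct.assoc k H H H).toLinearMap)

/-- Sweedler 2-cocycles (for the trivial action). -/
def IsZ2 (f : H ⊗[k] H →ₗ[k] A) : Prop :=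
  Normalized2 f ∧ IsConvInvertible f ∧ cocycle2LHS f = cocycle2RHS f

/-- The Sweedler 2-coboundary `∑ t(y₍₁₎) t⁻¹(x₍₁₎y₍₂₎) t(x₍₂₎)` of a 1-cochain `t`
with convolution inverse `tinv`. -/
noncomputable def cobound2 (t tinv : H →ₗ[k] A) : H ⊗[k] H →ₗ[k] A :=
  conv (t ∘ₗ dropL H H) (conv (tinv ∘ₗ LinearMap.mul' k H) (t ∘ₗ dropR H H))

/-- Sweedler 2-coboundaries (for the trivial action). -/
def IsB2 (f : H ⊗[k] H →ₗ[k] A) : Prop :=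
  ∃ t tinv : H →ₗ[k] A, Normalized1 t ∧ IsConvInv t tinv ∧ f = cobound2 t tinv

/-- Two 2-cochains are cohomologous when they differ (in convolution) by a 2-coboundary. -/
def Cohomologous2 (f f' : H ⊗[k] H →ₗ[k] A) : Prop :=
  ∃ b, IsB2 b ∧ f = conv f' b

/-- `(x⊗y)⊗z ↦ x ⊗ yz`. -/
noncomputable def m23 : (H ⊗[k] H) ⊗[k] H →ₗ[k] H ⊗[k] H :=
  LinearMap.lTensor H (LinearMap.mul' k H) ∘ₗ (TensorProduct.assoc k H H H).toLinearMap

/-- `(x⊗y)⊗z ↦ ε(x) (y⊗z)`. -/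
noncomputable def p23 : (H ⊗[k] H) ⊗[k] H →ₗ[k] H ⊗[k] H :=
  dropL H (H ⊗[k] H) ∘ₗ (TensorProduct.assoc k H H H).toLinearMap

/-- 3-cocycle condition
`∑ f(y₁⊗z₁⊗w₁) f(x₁⊗y₂z₂⊗w₂) f(x₂⊗y₃⊗z₃) = ∑ f(x₁y₁⊗z₁⊗w₁) f(x₂⊗y₂⊗z₂w₂)`. -/
def IsZ3cond (f : (H ⊗[k] H) ⊗[k] H →ₗ[k] A) : Prop :=
  conv (f ∘ₗ LinearMap.rTensor H (LinearMap.rTensor H (dropL H H)))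
    (conv (f ∘ₗ LinearMap.rTensor H (m23 (H := H)))
          (f ∘ₗ dropR ((H ⊗[k] H) ⊗[k] H) H))
  = conv (C := ((H ⊗[k] H) ⊗[k] H) ⊗[k] H)
         (f ∘ₗ LinearMap.rTensor H (LinearMap.rTensor H (LinearMap.mul' k H)))
         (f ∘ₗ (LinearMap.lTensor (H ⊗[k] H) (LinearMap.mul' k H)
              ∘ₗ (TensorProduct.assoc k (H ⊗[k] H) H H).toLinearMap :
                ((H ⊗[k] H) ⊗[k] H) ⊗[k] H →ₗ[k] (H ⊗[k] H) ⊗[k] H))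

/-- Sweedler 3-cocycles (for the trivial action). -/
def IsZ3 (f : (H ⊗[k] H) ⊗[k] H →ₗ[k] A) : Prop :=
  Normalized3 f ∧ IsConvInvertible f ∧ IsZ3cond f

/-- The Sweedler 3-coboundary
`∑ v(y₁⊗z₁) v⁻¹(x₁y₂⊗z₂) v(x₂⊗y₃z₃) v⁻¹(x₃⊗y₄)` of a 2-cochain `v`. -/
noncomputable def cobound3 (v vinv : H ⊗[k] H →ₗ[k] A) : (H ⊗[k] H) ⊗[k] H →ₗ[k] A :=
  conv (v ∘ₗ p23 (H := H))
    (conv (vinv ∘ₗ LinearMap.rTensor H (LinearMap.mul' k H))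
      (conv (v ∘ₗ m23 (H := H)) (vinv ∘ₗ dropR (H ⊗[k] H) H)))

/-- Sweedler 3-coboundaries (for the trivial action). -/
def IsB3 (f : (H ⊗[k] H) ⊗[k] H →ₗ[k] A) : Prop :=
  ∃ v vinv : H ⊗[k] H →ₗ[k] A, Normalized2 v ∧ IsConvInv v vinv ∧ f = cobound3 v vinv

/-- Cohomologous 3-cochains. -/
def Cohomologous3 (f f' : (H ⊗[k] H) ⊗[k] H →ₗ[k] A) : Prop :=
  ∃ b, IsB3 b ∧ f = conv f' b

end Sweedler

section Measuring

variable {k : Type} [Field k]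
variable {C : Type} [AddCommGroup C] [Module k C] [Coalgebra k C]
variable {N : Type} [Ring N] [Bialgebra k N]
variable {A : Type} [CommRing A] [Algebra k A]

/-- `(C, θ)` measures `N` to `A`:
`∑ θ(c₍₁₎ ⊗ n) θ(c₍₂₎ ⊗ n') = θ(c ⊗ nn')` and `θ(c ⊗ 1) = ε(c) 1`. -/
def Measures (θ : C ⊗[k] N →ₗ[k] A) : Prop :=
  (θ ∘ₗ LinearMap.lTensor C (LinearMap.mul' k N)
    = conv (θ ∘ₗ LinearMap.lTensor C (dropR N N)) (θ ∘ₗ LinearMap.lTensor C (dropL N N)))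
  ∧ ∀ c : C, θ (c ⊗ₜ[k] (1 : N)) = algebraMap k A (Coalgebra.counit c)

end Measuring

section Action

variable {k : Type} [Field k]
variable {T N : Type} [Ring T] [Bialgebra k T] [Ring N] [Bialgebra k N]

/-- `μ : T ⊗ N → N` makes `N` a left `T`-module bialgebra. -/
structure IsModuleBialgebra (μ : T ⊗[k] N →ₗ[k] N) : Prop where
  one_act : ∀ n : N, μ ((1 : T) ⊗ₜ[k] n) = n
  mul_act : ∀ (t s : T) (n : N), μ ((t * s) ⊗ₜ[k] n) = μ (t ⊗ₜ[k] μ (s ⊗ₜ[k] n))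
  act_one : ∀ t : T, μ (t ⊗ₜ[k] (1 : N)) = algebraMap k N (Coalgebra.counit t)
  act_mul : μ ∘ₗ LinearMap.lTensor T (LinearMap.mul' k N)
      = LinearMap.mul' k N ∘ₗ TensorProduct.map μ μ
          ∘ₗ (TensorProduct.tensorTensorTensorComm k T T N N).toLinearMap
          ∘ₗ LinearMap.rTensor (N ⊗[k] N) Coalgebra.comul
  comul_act : Coalgebra.comul ∘ₗ μ
      = TensorProduct.map μ μ
          ∘ₗ (TensorProduct.tensorTensorTensorComm k T T N N).toLinearMap
          ∘ₗ TensorProduct.map Coalgebra.comul Coalgebra.comul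
  counit_act : ∀ (t : T) (n : N),
      Coalgebra.counit (R := k) (μ (t ⊗ₜ[k] n))
        = Coalgebra.counit (R := k) t * Coalgebra.counit (R := k) n

/-- `t ⊗ n ↦ ∑ t₍₁₎(n) ⊗ t₍₂₎`. -/
noncomputable def smashCross (μ : T ⊗[k] N →ₗ[k] N) : T ⊗[k] N →ₗ[k] N ⊗[k] T :=
  TensorProduct.map μ LinearMap.id
    ∘ₗ (TensorProduct.assoc k T N T).symm.toLinearMap
    ∘ₗ LinearMap.lTensor T (TensorProduct.comm k T N).toLinearMap
    ∘ₗ (TensorProduct.assoc k T T N).toLinearMap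
    ∘ₗ LinearMap.rTensor N Coalgebra.comul

variable {H : Type} [Ring H] [Bialgebra k H]

/-- `H` is the smash product `N ⋊ T` along the action `μ`, with `N` and `T` included
as the Hopf subalgebras `N ⋊ 1` and `1 ⋊ T`; we identify `n ⋊ t = n t`. -/
structure IsSmashProduct (μ : T ⊗[k] N →ₗ[k] N) (iN : N →ₐc[k] H) (iT : T →ₐc[k] H) : Prop where
  act : IsModuleBialgebra μ
  injN : Function.Injective iN
  injT : Function.Injective iT
  /-- `n ⊗ t ↦ (n ⋊ 1)(1 ⋊ t)` is a linear isomorphism `N ⊗ T ≅ H` (`H` is the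
  tensor product coalgebra `N ⊗ T`). -/
  bij : Function.Bijective
    (LinearMap.mul' k H ∘ₗ TensorProduct.map (iN : N →ₗ[k] H) (iT : T →ₗ[k] H))
  /-- The smash relation `t n = ∑ t₍₁₎(n) t₍₂₎` in `H`. -/
  straighten : LinearMap.mul' k H ∘ₗ TensorProduct.map (iT : T →ₗ[k] H) (iN : N →ₗ[k] H)
      = LinearMap.mul' k H ∘ₗ TensorProduct.map (iN : N →ₗ[k] H) (iT : T →ₗ[k] H)
          ∘ₗ smashCross μ

end Action

section MeasCohomology

variable {k : Type} [Field k]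
variable {T N : Type} [Ring T] [Bialgebra k T] [Ring N] [Bialgebra k N]
variable {A : Type} [CommRing A] [Algebra k A]

/-- Normalization in the `T`-variable for measuring 1-cochains `T ⊗ N → A`. -/
def MeasNormalized1 (f : T ⊗[k] N →ₗ[k] A) : Prop :=
  ∀ n : N, f ((1 : T) ⊗ₜ[k] n) = algebraMap k A (Coalgebra.counit n)

/-- A measuring 1-cochain: an element of `Reg_meas(T, Hom(N,A))`. -/
def IsRegMeas1 (f : T ⊗[k] N →ₗ[k] A) : Prop :=
  Measures f ∧ MeasNormalized1 f ∧ IsConvInvertible f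

/-- The measuring 1-cocycle condition `f(ts)(n) = ∑ f(s₍₁₎)(n₍₁₎) f(t)(s₍₂₎(n₍₂₎))`. -/
def MeasCocycle1 (μ : T ⊗[k] N →ₗ[k] N) (f : T ⊗[k] N →ₗ[k] A) : Prop :=
  f ∘ₗ LinearMap.rTensor N (LinearMap.mul' k T)
    = conv (f ∘ₗ LinearMap.rTensor N (dropL T T))
      (f ∘ₗ LinearMap.lTensor T μ ∘ₗ (TensorProduct.assoc k T T N).toLinearMap)

/-- Measuring 1-cocycles. -/
def IsMeasZ1 (μ : T ⊗[k] N →ₗ[k] N) (f : T ⊗[k] N →ₗ[k] A) : Prop :=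
  IsRegMeas1 f ∧ MeasCocycle1 μ f

/-- Measuring 1-coboundaries: `f(t)(n) = ∑ g(n₍₁₎) g⁻¹(t(n₍₂₎))` for a
convolution-invertible algebra map `g : N → A`. -/
def IsMeasB1 (μ : T ⊗[k] N →ₗ[k] N) (f : T ⊗[k] N →ₗ[k] A) : Prop :=
  ∃ (g : N →ₐ[k] A) (ginv : N →ₗ[k] A), IsConvInv g.toLinearMap ginv ∧
    f = conv (g.toLinearMap ∘ₗ dropL T N) (ginv ∘ₗ μ)

/-- Normalization for measuring 2-cochains `(T ⊗ T) ⊗ N → A`. -/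
def MeasNormalized2 (f : (T ⊗[k] T) ⊗[k] N →ₗ[k] A) : Prop :=
  ∀ (t : T) (n : N),
    f (((1 : T) ⊗ₜ[k] t) ⊗ₜ[k] n)
        = algebraMap k A (Coalgebra.counit t * Coalgebra.counit n)
    ∧ f ((t ⊗ₜ[k] (1 : T)) ⊗ₜ[k] n)
        = algebraMap k A (Coalgebra.counit t * Coalgebra.counit n)

/-- A measuring 2-cochain: an element of `Reg_meas(T ⊗ T, Hom(N,A))`. -/
def IsRegMeas2 (f : (T ⊗[k] T) ⊗[k] N →ₗ[k] A) : Prop :=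
  Measures f ∧ MeasNormalized2 f ∧ IsConvInvertible f

/-- The measuring 2-cocycle condition
`∑ f(t₍₁₎⊗s₍₁₎)(r₍₁₎(n₍₁₎)) f(t₍₂₎s₍₂₎⊗r₍₂₎)(n₍₂₎) = ∑ f(s₍₁₎⊗r₍₁₎)(n₍₁₎) f(t⊗s₍₂₎r₍₂₎)(n₍₂₎)`. -/
def MeasCocycle2 (μ : T ⊗[k] N →ₗ[k] N) (f : (T ⊗[k] T) ⊗[k] N →ₗ[k] A) : Prop :=
  conv (C := ((T ⊗[k] T) ⊗[k] T) ⊗[k] N)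
       (f ∘ₗ (LinearMap.lTensor (T ⊗[k] T) μ
          ∘ₗ (TensorProduct.assoc k (T ⊗[k] T) T N).toLinearMap :
            ((T ⊗[k] T) ⊗[k] T) ⊗[k] N →ₗ[k] (T ⊗[k] T) ⊗[k] N))
       (f ∘ₗ LinearMap.rTensor N (LinearMap.rTensor T (LinearMap.mul' k T)))
    = conv (C := ((T ⊗[k] T) ⊗[k] T) ⊗[k] N)
           (f ∘ₗ LinearMap.rTensor N (LinearMap.rTensor T (dropL T T)))
           (f ∘ₗ LinearMap.rTensor N
              ((LinearMap.lTensor T (LinearMap.mul' k T)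
                ∘ₗ (TensorProduct.assoc k T T T).toLinearMap :
                  (T ⊗[k] T) ⊗[k] T →ₗ[k] T ⊗[k] T)))

/-- Measuring 2-cocycles. -/
def IsMeasZ2 (μ : T ⊗[k] N →ₗ[k] N) (f : (T ⊗[k] T) ⊗[k] N →ₗ[k] A) : Prop :=
  IsRegMeas2 f ∧ MeasCocycle2 μ f

/-- The measuring coboundary
`(t ⊗ s ⊗ n) ↦ ∑ g(s₍₁₎)(n₍₁₎) g⁻¹(t₍₁₎s₍₂₎)(n₍₂₎) g(t₍₂₎)(s₍₃₎(n₍₃₎))`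
of a 1-cochain `g` with convolution inverse `ginv`.  (For a 2-cocycle `f` on `N` with
stability witness `g`, this same formula is the map `d`. ) -/
noncomputable def measCobound (μ : T ⊗[k] N →ₗ[k] N) (g ginv : T ⊗[k] N →ₗ[k] A) :
    (T ⊗[k] T) ⊗[k] N →ₗ[k] A :=
  conv (g ∘ₗ LinearMap.rTensor N (dropL T T))
    (conv (ginv ∘ₗ LinearMap.rTensor N (LinearMap.mul' k T))
          (g ∘ₗ LinearMap.lTensor T μ ∘ₗ (TensorProduct.assoc k T T N).toLinearMap))

/-- Measuring 2-coboundaries. -/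
def IsMeasB2 (μ : T ⊗[k] N →ₗ[k] N) (f : (T ⊗[k] T) ⊗[k] N →ₗ[k] A) : Prop :=
  ∃ g ginv : T ⊗[k] N →ₗ[k] A, IsRegMeas1 g ∧ IsConvInv g ginv ∧ f = measCobound μ g ginv

/-- Cohomologous measuring 2-cochains. -/
def MeasCohomologous2 (μ : T ⊗[k] N →ₗ[k] N) (f f' : (T ⊗[k] T) ⊗[k] N →ₗ[k] A) : Prop :=
  ∃ b, IsMeasB2 μ b ∧ f = conv f' b

/-- `∑ f(n₍₁₎ ⊗ n'₍₁₎) f⁻¹(t₍₁₎(n₍₂₎) ⊗ t₍₂₎(n'₍₂₎))` as a map `T ⊗ (N ⊗ N) → A`. -/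
noncomputable def stabLHS (μ : T ⊗[k] N →ₗ[k] N) (f finv : N ⊗[k] N →ₗ[k] A) :
    T ⊗[k] (N ⊗[k] N) →ₗ[k] A :=
  conv (f ∘ₗ dropL T (N ⊗[k] N))
       (finv ∘ₗ TensorProduct.map μ μ
          ∘ₗ (TensorProduct.tensorTensorTensorComm k T T N N).toLinearMap
          ∘ₗ LinearMap.rTensor (N ⊗[k] N) Coalgebra.comul)

/-- `∑ g(t₍₁₎ ⊗ n₍₁₎) g⁻¹(t₍₂₎ ⊗ n₍₂₎n'₍₁₎) g(t₍₃₎ ⊗ n'₍₂₎)` as a map `T ⊗ (N ⊗ N) → A`. -/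
noncomputable def stabRHS (g ginv : T ⊗[k] N →ₗ[k] A) : T ⊗[k] (N ⊗[k] N) →ₗ[k] A :=
  conv (g ∘ₗ LinearMap.lTensor T (dropR N N))
    (conv (ginv ∘ₗ LinearMap.lTensor T (LinearMap.mul' k N))
          (g ∘ₗ LinearMap.lTensor T (dropL N N)))

/-- `g` (with convolution inverse `ginv`) witnesses the `T`-stability of the
2-cochain `f` on `N` (with convolution inverse `finv`):
`f * (f⁻¹)ᵗ = δ'(g(t ⊗ _))`. -/
def IsStabilityWitness (μ : T ⊗[k] N →ₗ[k] N) (f finv : N ⊗[k] N →ₗ[k] A)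
    (g ginv : T ⊗[k] N →ₗ[k] A) : Prop :=
  MeasNormalized1 g ∧ (∀ t : T, g (t ⊗ₜ[k] (1 : N)) = algebraMap k A (Coalgebra.counit t))
    ∧ IsConvInv g ginv ∧ stabLHS μ f finv = stabRHS g ginv

/-- The cohomology class of the 2-cocycle `f` on `N` is `T`-stable. -/
def IsTStable (μ : T ⊗[k] N →ₗ[k] N) (f finv : N ⊗[k] N →ₗ[k] A) : Prop :=
  ∃ g ginv, IsStabilityWitness μ f finv g ginv

end MeasCohomology

section SmashStatements

variable {k : Type} [Field k]
variable {T N H A : Type} [Ring T] [Bialgebra k T] [Ring N] [Bialgebra k N]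
  [Ring H] [Bialgebra k H] [CommRing A] [Algebra k A]

/-- `n ⊗ t ↦ (n ⋊ 1)(1 ⋊ t) = n ⋊ t`. -/
noncomputable def smashMul (iN : N →ₐc[k] H) (iT : T →ₐc[k] H) : N ⊗[k] T →ₗ[k] H :=
  LinearMap.mul' k H ∘ₗ TensorProduct.map iN.toLinearMap iT.toLinearMap

/-- The restriction of a 2-cochain on `H` to `N ⊗ N`. -/
noncomputable def resNN (iN : N →ₐc[k] H) (f : H ⊗[k] H →ₗ[k] A) : N ⊗[k] N →ₗ[k] A :=
  f ∘ₗ TensorProduct.map iN.toLinearMap iN.toLinearMap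

/-- The restriction of a 2-cochain on `H` to `T ⊗ T`. -/
noncomputable def resTT (iT : T →ₐc[k] H) (f : H ⊗[k] H →ₗ[k] A) : T ⊗[k] T →ₗ[k] A :=
  f ∘ₗ TensorProduct.map iT.toLinearMap iT.toLinearMap

/-- The restriction of a 2-cochain on `H` to `T ⊗ N`. -/
noncomputable def resTN (iN : N →ₐc[k] H) (iT : T →ₐc[k] H) (f : H ⊗[k] H →ₗ[k] A) :
    T ⊗[k] N →ₗ[k] A :=
  f ∘ₗ TensorProduct.map iT.toLinearMap iN.toLinearMap

/-- `f` is trivial on `N ⊗ T`: `f(n ⊗ t) = ε(n)ε(t)1`. -/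
def TrivialOnNT (iN : N →ₐc[k] H) (iT : T →ₐc[k] H) (f : H ⊗[k] H →ₗ[k] A) : Prop :=
  ∀ (n : N) (t : T), f (iN n ⊗ₜ[k] iT t)
    = algebraMap k A (Coalgebra.counit n * Coalgebra.counit t)

/-- `f` is trivial on `T ⊗ T`. -/
def TrivialOnTT (iT : T →ₐc[k] H) (f : H ⊗[k] H →ₗ[k] A) : Prop :=
  ∀ t t' : T, f (iT t ⊗ₜ[k] iT t')
    = algebraMap k A (Coalgebra.counit t * Coalgebra.counit t')

/-- `F` is the 2-cochain `ι f : (n ⋊ t) ⊗ (n' ⋊ t') ↦ ε(n) f(t)(n') ε(t')` on `H`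
associated with a measuring 1-cochain `f`. -/
def IotaOf (iN : N →ₐc[k] H) (iT : T →ₐc[k] H) (f : T ⊗[k] N →ₗ[k] A)
    (F : H ⊗[k] H →ₗ[k] A) : Prop :=
  ∀ (n : N) (t : T) (n' : N) (t' : T),
    F ((iN n * iT t) ⊗ₜ[k] (iN n' * iT t'))
      = algebraMap k A (Coalgebra.counit n * Coalgebra.counit t') * f (t ⊗ₜ[k] n')

/-- `J` is the 3-cochain
`jf : (n⋊t) ⊗ (n'⋊t') ⊗ (n''⋊t'') ↦ ε(n)ε(n') f(t⊗t')(n'') ε(t'')` on `H`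
associated with a measuring 2-cochain `f`. -/
def JOf (iN : N →ₐc[k] H) (iT : T →ₐc[k] H) (f : (T ⊗[k] T) ⊗[k] N →ₗ[k] A)
    (J : (H ⊗[k] H) ⊗[k] H →ₗ[k] A) : Prop :=
  ∀ (n : N) (t : T) (n' : N) (t' : T) (n'' : N) (t'' : T),
    J (((iN n * iT t) ⊗ₜ[k] (iN n' * iT t')) ⊗ₜ[k] (iN n'' * iT t''))
      = algebraMap k A (Coalgebra.counit n * Coalgebra.counit n' * Coalgebra.counit t'')
          * f ((t ⊗ₜ[k] t') ⊗ₜ[k] n'')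

end SmashStatements

end SmashPaper

open TensorProduct SmashPaper

namespace SmashPaper

section CommGroup

variable {G : Type} [CommGroup G]

lemma mul_inv_mul_eq_of_mul_inv_eq {u v w x₁ x₂ x₃ y₁ y₂ y₃ m₁ m₂ m₃ : G}
    (h₁ : u * w⁻¹ = x₁ * (m₁⁻¹ * y₁)) (h₂ : u * v⁻¹ = x₂ * (m₂⁻¹ * y₂))
    (h₃ : w * v⁻¹ = x₃ * (m₃⁻¹ * y₃)) :
    m₁ * (m₂⁻¹ * m₃) = x₁ * (x₂⁻¹ * x₃) * (y₁ * (y₂⁻¹ * y₃)) := by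
  apply Additive.ofMul.injective
  replace h₁ := congrArg Additive.ofMul h₁
  replace h₂ := congrArg Additive.ofMul h₂
  replace h₃ := congrArg Additive.ofMul h₃
  simp only [ofMul_mul, ofMul_inv] at h₁ h₂ h₃ ⊢
  linear_combination (norm := abel) h₁ - h₂ + h₃

lemma mul_inv_eq_mul_of_mul_inv_mul_eq {x y m x' y' m' : G}
    (h : x * (m⁻¹ * y) = x' * (m'⁻¹ * y')) : m * m'⁻¹ = x * x'⁻¹ * (y * y'⁻¹) := by
  apply Additive.ofMul.injective
  replace h := congrArg Additive.ofMul h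
  simp only [ofMul_mul, ofMul_inv] at h ⊢
  linear_combination (norm := abel) -h

lemma mul_inv_mul_eq_of_mul_inv_mul_eq {x y m a b c a' b' c' : G}
    (h : b * (c⁻¹ * a) * (b' * (c'⁻¹ * a'))⁻¹ = x * (m⁻¹ * y)) :
    m * (c⁻¹ * c') = x * (a⁻¹ * a') * (y * (b⁻¹ * b')) := by
  apply Additive.ofMul.injective
  replace h := congrArg Additive.ofMul h
  simp only [ofMul_mul, ofMul_inv] at h ⊢
  linear_combination (norm := abel) h

end CommGroup

section CoalgHoms

variable {k : Type} [Field k]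

section Proj

variable (C D : Type) [AddCommGroup C] [Module k C] [Coalgebra k C]
  [AddCommGroup D] [Module k D] [Coalgebra k D]

/-- The projection `c ⊗ d ↦ ε(d) c` as a coalgebra morphism. -/
noncomputable def fstHom : C ⊗[k] D →ₗc[k] C :=
  (Coalgebra.TensorProduct.rid k k C).toCoalgHom.comp
    (Coalgebra.TensorProduct.map (CoalgHom.id k C) (Coalgebra.counitCoalgHom k D))

/-- The projection `c ⊗ d ↦ ε(c) d` as a coalgebra morphism. -/
noncomputable def sndHom : C ⊗[k] D →ₗc[k] D :=
  (Coalgebra.TensorProduct.lid k D).toCoalgHom.comp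
    (Coalgebra.TensorProduct.map (Coalgebra.counitCoalgHom k C) (CoalgHom.id k D))

@[simp] lemma fstHom_tmul (c : C) (d : D) :
    fstHom C D (c ⊗ₜ[k] d) = Coalgebra.counit (R := k) d • c := rfl

@[simp] lemma sndHom_tmul (c : C) (d : D) :
    sndHom C D (c ⊗ₜ[k] d) = Coalgebra.counit (R := k) c • d := rfl

lemma map_fstHom_sndHom_comp_comul :
    TensorProduct.map (fstHom C D).toLinearMap (sndHom C D).toLinearMap ∘ₗ Coalgebra.comul
      = LinearMap.id (R := k) := by
  have h : TensorProduct.map (fstHom C D).toLinearMap (sndHom C D).toLinearMap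
        ∘ₗ (TensorProduct.tensorTensorTensorComm k C C D D).toLinearMap
      = TensorProduct.map
          ((TensorProduct.rid k C).toLinearMap ∘ₗ LinearMap.lTensor C (Coalgebra.counit (R := k)))
          ((TensorProduct.lid k D).toLinearMap
            ∘ₗ LinearMap.rTensor D (Coalgebra.counit (R := k))) := by
    ext a b c d
    change (Coalgebra.counit (R := k) c • a) ⊗ₜ[k] (Coalgebra.counit (R := k) b • d)
      = (Coalgebra.counit (R := k) b • a) ⊗ₜ[k] (Coalgebra.counit (R := k) c • d)
    rw [TensorProduct.smul_tmul_smul, TensorProduct.smul_tmul_smul, mul_comm]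
  ext c d
  have := LinearMap.congr_fun h (Coalgebra.comul (R := k) c ⊗ₜ Coalgebra.comul (R := k) d)
  simpa [TensorProduct.comul_tmul, TensorProduct.AlgebraTensorModule.tensorTensorTensorComm_eq]
    using this

variable {C D}

/-- A coalgebra morphism into `C ⊗ D` is determined by its two components. -/
lemma coalgHom_tensor_ext {E : Type} [AddCommGroup E] [Module k E] [Coalgebra k E]
    {φ ψ : E →ₗc[k] C ⊗[k] D} (h₁ : (fstHom C D).comp φ = (fstHom C D).comp ψ)
    (h₂ : (sndHom C D).comp φ = (sndHom C D).comp ψ) : φ = ψ := by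
  have key (χ : E →ₗc[k] C ⊗[k] D) : χ.toLinearMap = TensorProduct.map
      ((fstHom C D).comp χ).toLinearMap ((sndHom C D).comp χ).toLinearMap ∘ₗ Coalgebra.comul := by
    have : TensorProduct.map ((fstHom C D).comp χ).toLinearMap ((sndHom C D).comp χ).toLinearMap
        = TensorProduct.map (fstHom C D).toLinearMap (sndHom C D).toLinearMap
          ∘ₗ TensorProduct.map χ.toLinearMap χ.toLinearMap := TensorProduct.map_comp _ _ _ _
    rw [this, LinearMap.comp_assoc, χ.map_comp_comul, ← LinearMap.comp_assoc,
      map_fstHom_sndHom_comp_comul, LinearMap.id_comp]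
  have h : φ.toLinearMap = ψ.toLinearMap := by rw [key φ, key ψ, h₁, h₂]
  ext x
  exact LinearMap.congr_fun h x

section Pair

variable {E : Type} [AddCommGroup E] [Module k E] [Coalgebra k E] [Coalgebra.IsCocomm k E]
  (φ : E →ₗc[k] C) (ψ : E →ₗc[k] D)

/-- The coalgebra morphism `x ↦ ∑ φ(x₍₁₎) ⊗ ψ(x₍₂₎)`. -/
noncomputable def pairHom : E →ₗc[k] C ⊗[k] D :=
  (Coalgebra.TensorProduct.map φ ψ).comp (Coalgebra.comulCoalgHom k E)

@[simp] lemma fstHom_comp_pairHom : (fstHom C D).comp (pairHom φ ψ) = φ := by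
  have h : (fstHom C D).toLinearMap ∘ₗ TensorProduct.map φ.toLinearMap ψ.toLinearMap
      = φ.toLinearMap ∘ₗ (TensorProduct.rid k E).toLinearMap
        ∘ₗ LinearMap.lTensor E (Coalgebra.counit (R := k)) := by
    ext; simp
  ext x
  exact (LinearMap.congr_fun h (Coalgebra.comul x)).trans (by simp)

@[simp] lemma sndHom_comp_pairHom : (sndHom C D).comp (pairHom φ ψ) = ψ := by
  have h : (sndHom C D).toLinearMap ∘ₗ TensorProduct.map φ.toLinearMap ψ.toLinearMap
      = ψ.toLinearMap ∘ₗ (TensorProduct.lid k E).toLinearMap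
        ∘ₗ LinearMap.rTensor E (Coalgebra.counit (R := k)) := by
    ext; simp
  ext x
  exact (LinearMap.congr_fun h (Coalgebra.comul x)).trans (by simp)

end Pair

end Proj

section Unit

variable (C N : Type) [AddCommGroup C] [Module k C] [Coalgebra k C] [Ring N] [Bialgebra k N]

/-- `c ↦ c ⊗ 1` as a coalgebra morphism. -/
noncomputable def inlHom : C →ₗc[k] C ⊗[k] N where
  toLinearMap := (TensorProduct.mk k C N).flip 1
  counit_comp := by ext; simp
  map_comp_comul := by
    ext c
    simp only [LinearMap.comp_apply, LinearMap.flip_apply, TensorProduct.mk_apply,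
      TensorProduct.comul_tmul, Bialgebra.comul_one, Algebra.TensorProduct.one_def]
    hopf_tensor_induction Coalgebra.comul (R := k) c with c₁ c₂
    simp

/-- `c ↦ 1 ⊗ c` as a coalgebra morphism. -/
noncomputable def inrHom : C →ₗc[k] N ⊗[k] C where
  toLinearMap := TensorProduct.mk k N C 1
  counit_comp := by ext; simp
  map_comp_comul := by
    ext c
    simp only [LinearMap.comp_apply, TensorProduct.mk_apply,
      TensorProduct.comul_tmul, Bialgebra.comul_one, Algebra.TensorProduct.one_def]
    hopf_tensor_induction Coalgebra.comul (R := k) c with c₁ c₂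
    simp

@[simp] lemma inlHom_apply (c : C) : inlHom C N c = c ⊗ₜ[k] 1 := rfl

@[simp] lemma inrHom_apply (c : C) : inrHom C N c = (1 : N) ⊗ₜ[k] c := rfl

end Unit

section Tensor

variable {C C' D D' : Type} [AddCommMonoid C] [Module k C] [Coalgebra k C]
  [AddCommMonoid C'] [Module k C'] [Coalgebra k C'] [AddCommMonoid D] [Module k D] [Coalgebra k D]
  [AddCommMonoid D'] [Module k D'] [Coalgebra k D']

variable (C) in
/-- `C ⊗ ψ` as a coalgebra morphism. -/
noncomputable def lT (ψ : D →ₗc[k] D') : C ⊗[k] D →ₗc[k] C ⊗[k] D' :=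
  Coalgebra.TensorProduct.map (CoalgHom.id k C) ψ

variable (D) in
/-- `φ ⊗ D` as a coalgebra morphism. -/
noncomputable def rT (φ : C →ₗc[k] C') : C ⊗[k] D →ₗc[k] C' ⊗[k] D :=
  Coalgebra.TensorProduct.map φ (CoalgHom.id k D)

@[simp] lemma lT_tmul (ψ : D →ₗc[k] D') (c : C) (d : D) :
    lT C ψ (c ⊗ₜ[k] d) = c ⊗ₜ[k] ψ d := rfl

@[simp] lemma rT_tmul (φ : C →ₗc[k] C') (c : C) (d : D) :
    rT D φ (c ⊗ₜ[k] d) = φ c ⊗ₜ[k] d := rfl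

lemma rT_comp_lT (φ : C →ₗc[k] C') (ψ : D →ₗc[k] D') :
    (rT D' φ).comp (lT C ψ) = (lT C' ψ).comp (rT D φ) := by
  apply CoalgHom.coe_linearMap_injective
  ext
  rfl

end Tensor

lemma sndHom_comp_lT (C : Type) {D D' : Type} [AddCommGroup C] [Module k C] [Coalgebra k C]
    [AddCommGroup D] [Module k D] [Coalgebra k D] [AddCommGroup D'] [Module k D']
    [Coalgebra k D'] (ψ : D →ₗc[k] D') :
    (sndHom C D').comp (lT C ψ) = ψ.comp (sndHom C D) := by
  apply CoalgHom.coe_linearMap_injective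
  ext
  simp

end CoalgHoms

section Pullback

variable {k : Type} [Field k] {C D E : Type} [AddCommMonoid C] [Module k C] [Coalgebra k C]
  [AddCommMonoid D] [Module k D] [Coalgebra k D] [AddCommMonoid E] [Module k E] [Coalgebra k E]
  {A : Type} [CommRing A] [Algebra k A]

variable (k C A) in
/-- The group of convolution-invertible linear maps. -/
abbrev Reg : Type := (WithConv (C →ₗ[k] A))ˣ

/-- The linear map underlying a convolution-invertible map. -/
abbrev Reg.toLin (g : Reg k C A) : C →ₗ[k] A := g.val.ofConv

lemma Reg.ext_toLin {g h : Reg k C A} (H : g.toLin = h.toLin) : g = h :=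
  Units.ext (WithConv.ext H)

/-- Precomposition with a coalgebra morphism. -/
noncomputable def pull (φ : D →ₗc[k] C) : Reg k C A →* Reg k D A :=
  Units.map
    { toFun := fun f => WithConv.toConv (f.ofConv ∘ₗ φ.toLinearMap)
      map_one' := by
        rw [LinearMap.convOne_def, LinearMap.convOne_def, WithConv.ofConv_toConv,
          LinearMap.comp_assoc, φ.counit_comp]
      map_mul' := fun f g => WithConv.ext (LinearMap.convMul_comp_coalgHom_distrib f g φ) }

lemma pull_toLin (φ : D →ₗc[k] C) (g : Reg k C A) :
    (pull φ g).toLin = g.toLin ∘ₗ φ.toLinearMap := rfl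

lemma pull_pull (φ : D →ₗc[k] C) (ψ : E →ₗc[k] D) (g : Reg k C A) :
    pull ψ (pull φ g) = pull (φ.comp ψ) g := rfl

lemma pull_eq_of_comp_eq {C' : Type} [AddCommMonoid C'] [Module k C'] [Coalgebra k C']
    {φ : D →ₗc[k] C} {ψ : E →ₗc[k] D} {φ' : C' →ₗc[k] C} {ψ' : E →ₗc[k] C'}
    (h : φ.comp ψ = φ'.comp ψ') (g : Reg k C A) :
    pull ψ (pull φ g) = pull ψ' (pull φ' g) := by
  rw [pull_pull, pull_pull, h]

lemma pull_lT_pull_rT {C' D' : Type} [AddCommMonoid C'] [Module k C'] [Coalgebra k C']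
    [AddCommMonoid D'] [Module k D'] [Coalgebra k D'] (φ : C →ₗc[k] C') (ψ : D →ₗc[k] D')
    (g : Reg k (C' ⊗[k] D') A) :
    pull (lT C ψ) (pull (rT D' φ) g) = pull (rT D φ) (pull (lT C' ψ) g) :=
  pull_eq_of_comp_eq (rT_comp_lT φ ψ) g

end Pullback

lemma pull_lT_pull_sndHom {k : Type} [Field k] {C D D' A : Type}
    [AddCommGroup C] [Module k C] [Coalgebra k C] [AddCommGroup D] [Module k D] [Coalgebra k D]
    [AddCommGroup D'] [Module k D'] [Coalgebra k D'] [CommRing A] [Algebra k A]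
    (ψ : D →ₗc[k] D') (g : Reg k D' A) :
    pull (lT C ψ) (pull (sndHom C D') g) = pull (sndHom C D) (pull ψ g) :=
  pull_eq_of_comp_eq (sndHom_comp_lT C ψ) g

section Conv

variable {k : Type} [Field k] {C A : Type} [AddCommGroup C] [Module k C] [Coalgebra k C]
  [CommRing A] [Algebra k A]

/-- A map with a convolution inverse as an element of the convolution group. -/
def IsConvInv.toReg {f finv : C →ₗ[k] A} (h : IsConvInv f finv) : Reg k C A :=
  ⟨WithConv.toConv f, WithConv.toConv finv, WithConv.ext h.1, WithConv.ext h.2⟩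

lemma Reg.isConvInv (g : Reg k C A) : IsConvInv g.toLin g⁻¹.toLin :=
  ⟨congrArg WithConv.ofConv g.mul_inv, congrArg WithConv.ofConv g.inv_mul⟩

lemma Reg.toLin_mul (g h : Reg k C A) : (g * h).toLin = conv g.toLin h.toLin := rfl

end Conv

section Action

variable {k : Type} [Field k] {T N A : Type} [Ring T] [Bialgebra k T] [Ring N] [Bialgebra k N]
  [CommRing A] [Algebra k A] {μ : T ⊗[k] N →ₗ[k] N}

namespace IsModuleBialgebra

/-- The action as a coalgebra morphism. -/
noncomputable def actHom (hμ : IsModuleBialgebra μ) : T ⊗[k] N →ₗc[k] N where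
  toLinearMap := μ
  counit_comp := by
    ext t n
    simp [hμ.counit_act, mul_comm]
  map_comp_comul := by
    rw [hμ.comul_act, TensorProduct.comul_def]
    simp [TensorProduct.AlgebraTensorModule.tensorTensorTensorComm_eq,
      TensorProduct.AlgebraTensorModule.map_eq]

@[simp] lemma actHom_apply (hμ : IsModuleBialgebra μ) (x : T ⊗[k] N) : hμ.actHom x = μ x := rfl

/-- The diagonal action `t ⊗ (n ⊗ n') ↦ ∑ t₍₁₎(n) ⊗ t₍₂₎(n')`. -/
noncomputable def diag (μ : T ⊗[k] N →ₗ[k] N) : T ⊗[k] (N ⊗[k] N) →ₗ[k] N ⊗[k] N :=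
  TensorProduct.map μ μ ∘ₗ (TensorProduct.tensorTensorTensorComm k T T N N).toLinearMap
    ∘ₗ LinearMap.rTensor (N ⊗[k] N) Coalgebra.comul

/-- `(t ⊗ s) ⊗ x ↦ t ⊗ s(x)` for the action `μ`. -/
noncomputable def innerHom (hμ : IsModuleBialgebra μ) : (T ⊗[k] T) ⊗[k] N →ₗc[k] T ⊗[k] N :=
  (lT T hμ.actHom).comp (Coalgebra.TensorProduct.assoc k k T T N).toCoalgHom

@[simp] lemma innerHom_tmul (hμ : IsModuleBialgebra μ) (t s : T) (n : N) :
    hμ.innerHom ((t ⊗ₜ[k] s) ⊗ₜ[k] n) = t ⊗ₜ[k] μ (s ⊗ₜ[k] n) := rfl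

lemma actHom_comp_innerHom (hμ : IsModuleBialgebra μ) :
    hμ.actHom.comp hμ.innerHom
      = hμ.actHom.comp (rT N (Bialgebra.mulCoalgHom k T)) := by
  apply CoalgHom.coe_linearMap_injective
  ext t s n
  exact (hμ.mul_act t s n).symm

variable [Coalgebra.IsCocomm k T] [Coalgebra.IsCocomm k N]

/-- The diagonal action as a coalgebra morphism. -/
noncomputable def diagHom (hμ : IsModuleBialgebra μ) : T ⊗[k] (N ⊗[k] N) →ₗc[k] N ⊗[k] N :=
  pairHom (hμ.actHom.comp (lT T (fstHom N N)))
    (hμ.actHom.comp (lT T (sndHom N N)))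

lemma diagHom_toLinearMap (hμ : IsModuleBialgebra μ) : hμ.diagHom.toLinearMap = diag μ := by
  have h : TensorProduct.map (μ ∘ₗ LinearMap.lTensor T (fstHom N N).toLinearMap)
        (μ ∘ₗ LinearMap.lTensor T (sndHom N N).toLinearMap)
        ∘ₗ (TensorProduct.tensorTensorTensorComm k T T (N ⊗[k] N) (N ⊗[k] N)).toLinearMap
      = TensorProduct.map μ μ ∘ₗ (TensorProduct.tensorTensorTensorComm k T T N N).toLinearMap
        ∘ₗ LinearMap.lTensor (T ⊗[k] T)
          (TensorProduct.map (fstHom N N).toLinearMap (sndHom N N).toLinearMap) := by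
    ext a b c d e f
    simp
  ext t n n'
  have h₁ := LinearMap.congr_fun h
    (Coalgebra.comul (R := k) t ⊗ₜ Coalgebra.comul (R := k) (n ⊗ₜ[k] n'))
  have h₂ := LinearMap.congr_fun (map_fstHom_sndHom_comp_comul (k := k) N N) (n ⊗ₜ n')
  simp only [LinearMap.comp_apply, LinearEquiv.coe_coe, LinearMap.lTensor_tmul] at h₁ h₂
  rw [h₂] at h₁
  exact h₁

@[simp] lemma fstHom_comp_diagHom (hμ : IsModuleBialgebra μ) :
    (fstHom N N).comp hμ.diagHom = hμ.actHom.comp (lT T (fstHom N N)) :=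
  fstHom_comp_pairHom _ _

@[simp] lemma sndHom_comp_diagHom (hμ : IsModuleBialgebra μ) :
    (sndHom N N).comp hμ.diagHom = hμ.actHom.comp (lT T (sndHom N N)) :=
  sndHom_comp_pairHom _ _

lemma actHom_comp_lT_mul (hμ : IsModuleBialgebra μ) :
    hμ.actHom.comp (lT T (Bialgebra.mulCoalgHom k N))
      = (Bialgebra.mulCoalgHom k N).comp hμ.diagHom := by
  have h : (Bialgebra.mulCoalgHom k N).toLinearMap ∘ₗ hμ.diagHom.toLinearMap
      = μ ∘ₗ LinearMap.lTensor T (LinearMap.mul' k N) := by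
    rw [diagHom_toLinearMap, hμ.act_mul]
    rfl
  ext x
  exact (LinearMap.congr_fun h x).symm

/-- `(t ⊗ s) ⊗ x ↦ t ⊗ s(x)` for the diagonal action on `N ⊗ N`. -/
noncomputable def innerDiagHom (hμ : IsModuleBialgebra μ) :
    (T ⊗[k] T) ⊗[k] (N ⊗[k] N) →ₗc[k] T ⊗[k] (N ⊗[k] N) :=
  (lT T hμ.diagHom).comp
    (Coalgebra.TensorProduct.assoc k k T T (N ⊗[k] N)).toCoalgHom

@[simp] lemma innerDiagHom_tmul (hμ : IsModuleBialgebra μ) (t s : T) (x : N ⊗[k] N) :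
    hμ.innerDiagHom ((t ⊗ₜ[k] s) ⊗ₜ[k] x) = t ⊗ₜ[k] hμ.diagHom (s ⊗ₜ[k] x) := rfl

lemma innerHom_comp_lT (hμ : IsModuleBialgebra μ) {φ ψ : N ⊗[k] N →ₗc[k] N}
    (h : hμ.actHom.comp (lT T φ) = ψ.comp hμ.diagHom) :
    hμ.innerHom.comp (lT (T ⊗[k] T) φ)
      = (lT T ψ).comp hμ.innerDiagHom := by
  apply CoalgHom.coe_linearMap_injective
  ext t s n n'
  exact congrArg (t ⊗ₜ[k] ·) (DFunLike.congr_fun h (s ⊗ₜ (n ⊗ₜ n')))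

lemma diagHom_comp_innerDiagHom (hμ : IsModuleBialgebra μ) :
    hμ.diagHom.comp hμ.innerDiagHom
      = hμ.diagHom.comp (rT (N ⊗[k] N) (Bialgebra.mulCoalgHom k T)) := by
  have key {φ : N ⊗[k] N →ₗc[k] N}
      (h : hμ.actHom.comp (lT T φ) = φ.comp hμ.diagHom) :
      φ.comp (hμ.diagHom.comp hμ.innerDiagHom)
        = φ.comp (hμ.diagHom.comp
          (rT (N ⊗[k] N) (Bialgebra.mulCoalgHom k T))) := by
    rw [← CoalgHom.comp_assoc, ← h, CoalgHom.comp_assoc, ← hμ.innerHom_comp_lT h,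
      ← CoalgHom.comp_assoc, actHom_comp_innerHom, ← CoalgHom.comp_assoc, ← h,
      CoalgHom.comp_assoc, rT_comp_lT, CoalgHom.comp_assoc]
  exact coalgHom_tensor_ext (key (by simp)) (key (by simp))

/-- The coboundary `g ↦ ((t ⊗ s) ⊗ n ↦ ∑ g(s₍₁₎)(n₍₁₎) g⁻¹(t₍₁₎s₍₂₎)(n₍₂₎) g(t₍₂₎)(s₍₃₎(n₍₃₎)))`
as a homomorphism of convolution groups. -/
noncomputable def coboundHom (hμ : IsModuleBialgebra μ) :
    Reg k (T ⊗[k] N) A →* Reg k ((T ⊗[k] T) ⊗[k] N) A :=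
  pull (rT N (sndHom T T))
    * ((pull (rT N (Bialgebra.mulCoalgHom k T)))⁻¹ * pull hμ.innerHom)

lemma coboundHom_apply (hμ : IsModuleBialgebra μ) (g : Reg k (T ⊗[k] N) A) :
    hμ.coboundHom g = pull (rT N (sndHom T T)) g
      * ((pull (rT N (Bialgebra.mulCoalgHom k T)) g)⁻¹ * pull hμ.innerHom g) := rfl

lemma measCobound_toLin (hμ : IsModuleBialgebra μ) (g : Reg k (T ⊗[k] N) A) :
    measCobound μ g.toLin g⁻¹.toLin = (hμ.coboundHom g).toLin := rfl

/-- The witness condition, expressed in the convolution group of `T ⊗ (N ⊗ N)`. -/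
lemma stab_iff (hμ : IsModuleBialgebra μ) (f : Reg k (N ⊗[k] N) A) (g : Reg k (T ⊗[k] N) A) :
    stabLHS μ f.toLin f⁻¹.toLin = stabRHS g.toLin g⁻¹.toLin ↔
      pull (sndHom T (N ⊗[k] N)) f * (pull hμ.diagHom f)⁻¹
        = pull (lT T (fstHom N N)) g
          * ((pull (lT T (Bialgebra.mulCoalgHom k N)) g)⁻¹
            * pull (lT T (sndHom N N)) g) := by
  have h : (pull (sndHom T (N ⊗[k] N)) f * (pull hμ.diagHom f)⁻¹).toLin
      = stabLHS μ f.toLin f⁻¹.toLin := by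
    rw [Reg.toLin_mul, ← map_inv, pull_toLin, pull_toLin, diagHom_toLinearMap]
    rfl
  rw [← h]
  exact ⟨fun H => Reg.ext_toLin H, fun H => congrArg Reg.toLin H⟩

end IsModuleBialgebra

section Measuring

variable {C : Type} [AddCommGroup C] [Module k C] [Coalgebra k C]

lemma pull_inlHom_eq_one_iff (θ : Reg k (C ⊗[k] N) A) :
    pull (inlHom C N) θ = 1 ↔
      ∀ c : C, θ.toLin (c ⊗ₜ[k] (1 : N)) = algebraMap k A (Coalgebra.counit c) :=
  ⟨fun h c => LinearMap.congr_fun (congrArg Reg.toLin h) c,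
    fun h => Reg.ext_toLin (LinearMap.ext h)⟩

lemma pull_inrHom_eq_one_iff (g : Reg k (T ⊗[k] N) A) :
    pull (inrHom N T) g = 1 ↔ MeasNormalized1 g.toLin :=
  ⟨fun h n => LinearMap.congr_fun (congrArg Reg.toLin h) n,
    fun h => Reg.ext_toLin (LinearMap.ext h)⟩

lemma measNormalized2_iff (f : Reg k ((T ⊗[k] T) ⊗[k] N) A) :
    MeasNormalized2 f.toLin ↔ pull (D := T ⊗[k] N) (rT N (inrHom T T)) f = 1
      ∧ pull (D := T ⊗[k] N) (rT N (inlHom T T)) f = 1 := by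
  have hc (t : T) (n : N) : (1 : Reg k (T ⊗[k] N) A).toLin (t ⊗ₜ n)
      = algebraMap k A (Coalgebra.counit t * Coalgebra.counit n) := by
    rw [map_mul, mul_comm, ← map_mul]
    rfl
  constructor
  · intro h
    constructor <;> refine Reg.ext_toLin (TensorProduct.ext' fun t n => ?_)
    · exact (h t n).1.trans (hc t n).symm
    · exact (h t n).2.trans (hc t n).symm
  · intro h t n
    exact ⟨(LinearMap.congr_fun (congrArg Reg.toLin h.1) (t ⊗ₜ n)).trans (hc t n),
      (LinearMap.congr_fun (congrArg Reg.toLin h.2) (t ⊗ₜ n)).trans (hc t n)⟩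

lemma measures_iff (θ : Reg k (C ⊗[k] N) A) :
    Measures θ.toLin ↔ pull (lT C (Bialgebra.mulCoalgHom k N)) θ
        = pull (lT C (fstHom N N)) θ * pull (lT C (sndHom N N)) θ
      ∧ pull (inlHom C N) θ = 1 := by
  rw [pull_inlHom_eq_one_iff]
  exact and_congr_left fun _ => ⟨fun H => Reg.ext_toLin H, fun H => congrArg Reg.toLin H⟩

end Measuring

namespace IsModuleBialgebra

variable [Coalgebra.IsCocomm k T] [Coalgebra.IsCocomm k N]

lemma measNormalized2_coboundHom (hμ : IsModuleBialgebra μ) {g : Reg k (T ⊗[k] N) A}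
    (hg : pull (inrHom N T) g = 1) : MeasNormalized2 (hμ.coboundHom g).toLin := by
  rw [measNormalized2_iff, coboundHom_apply]
  have e₁ : (rT N (sndHom T T)).comp (rT N (inrHom T T))
      = CoalgHom.id k (T ⊗[k] N) := by
    apply CoalgHom.coe_linearMap_injective
    ext; simp
  have e₂ : (rT N (Bialgebra.mulCoalgHom k T)).comp
      (rT N (inrHom T T)) = CoalgHom.id k (T ⊗[k] N) := by
    apply CoalgHom.coe_linearMap_injective
    ext; simp
  have e₃ : hμ.innerHom.comp (rT N (inrHom T T))
      = (inrHom N T).comp hμ.actHom := by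
    apply CoalgHom.coe_linearMap_injective
    ext; simp
  have e₄ : (rT N (sndHom T T)).comp (rT N (inlHom T T : T →ₗc[k] T ⊗[k] T))
      = (inrHom N T).comp (sndHom T N) := by
    apply CoalgHom.coe_linearMap_injective
    ext; simp [TensorProduct.smul_tmul]
  have e₅ : (rT N (Bialgebra.mulCoalgHom k T)).comp
      (rT N (inlHom T T : T →ₗc[k] T ⊗[k] T)) = CoalgHom.id k (T ⊗[k] N) := by
    apply CoalgHom.coe_linearMap_injective
    ext; simp
  have e₆ : hμ.innerHom.comp (rT N (inlHom T T : T →ₗc[k] T ⊗[k] T))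
      = CoalgHom.id k (T ⊗[k] N) := by
    apply CoalgHom.coe_linearMap_injective
    ext; simp [hμ.one_act]
  constructor
  · rw [map_mul, map_mul, map_inv, pull_pull, pull_pull, pull_pull, e₁, e₂, e₃, ← pull_pull, hg]
    simp
  · rw [map_mul, map_mul, map_inv, pull_pull, pull_pull, pull_pull, e₄, e₅, e₆, ← pull_pull, hg]
    simp

lemma pull_inlHom_coboundHom (hμ : IsModuleBialgebra μ) {g : Reg k (T ⊗[k] N) A}
    (hg : pull (inlHom T N) g = 1) : pull (inlHom (T ⊗[k] T) N) (hμ.coboundHom g) = 1 := by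
  have e₁ : (rT N (sndHom T T)).comp (inlHom (T ⊗[k] T) N)
      = (inlHom T N).comp (sndHom T T) := by
    apply CoalgHom.coe_linearMap_injective
    ext; simp [TensorProduct.smul_tmul']
  have e₂ : (rT N (Bialgebra.mulCoalgHom k T)).comp (inlHom (T ⊗[k] T) N)
      = (inlHom T N).comp (Bialgebra.mulCoalgHom k T) := by
    apply CoalgHom.coe_linearMap_injective
    ext; simp
  have e₃ : hμ.innerHom.comp (inlHom (T ⊗[k] T) N) = (inlHom T N).comp (fstHom T T) := by
    apply CoalgHom.coe_linearMap_injective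
    ext; simp [hμ.act_one, Algebra.algebraMap_eq_smul_one, TensorProduct.smul_tmul']
  rw [coboundHom_apply, map_mul, map_mul, map_inv, pull_eq_of_comp_eq e₁, pull_eq_of_comp_eq e₂,
    pull_eq_of_comp_eq e₃, hg]
  simp

lemma measCocycle2_coboundHom (hμ : IsModuleBialgebra μ) (g : Reg k (T ⊗[k] N) A) :
    MeasCocycle2 μ (hμ.coboundHom g).toLin := by
  let φ₁ : ((T ⊗[k] T) ⊗[k] T) ⊗[k] N →ₗc[k] (T ⊗[k] T) ⊗[k] N :=
    (lT (T ⊗[k] T) hμ.actHom).comp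
      (Coalgebra.TensorProduct.assoc k k (T ⊗[k] T) T N).toCoalgHom
  let φ₂ : ((T ⊗[k] T) ⊗[k] T) ⊗[k] N →ₗc[k] (T ⊗[k] T) ⊗[k] N :=
    rT N (rT T (Bialgebra.mulCoalgHom k T))
  let φ₃ : ((T ⊗[k] T) ⊗[k] T) ⊗[k] N →ₗc[k] (T ⊗[k] T) ⊗[k] N :=
    rT N (rT T (sndHom T T))
  let φ₄ : ((T ⊗[k] T) ⊗[k] T) ⊗[k] N →ₗc[k] (T ⊗[k] T) ⊗[k] N :=
    rT N ((lT T (Bialgebra.mulCoalgHom k T)).comp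
      (Coalgebra.TensorProduct.assoc k k T T T).toCoalgHom)
  let α : (T ⊗[k] T) ⊗[k] N →ₗc[k] T ⊗[k] N := rT N (sndHom T T)
  let β : (T ⊗[k] T) ⊗[k] N →ₗc[k] T ⊗[k] N := rT N (Bialgebra.mulCoalgHom k T)
  have e₁ : α.comp φ₁ = hμ.innerHom.comp φ₃ := by
    apply CoalgHom.coe_linearMap_injective
    ext; simp [α, φ₁, φ₃]
  have e₂ : β.comp φ₁ = hμ.innerHom.comp φ₂ := by
    apply CoalgHom.coe_linearMap_injective
    ext; simp [β, φ₁, φ₂]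
  have e₃ : hμ.innerHom.comp φ₁ = hμ.innerHom.comp φ₄ := by
    apply CoalgHom.coe_linearMap_injective
    ext; simp [φ₁, φ₄, hμ.mul_act]
  have e₄ : α.comp φ₂ = α.comp φ₃ := by
    apply CoalgHom.coe_linearMap_injective
    ext; simp [α, φ₂, φ₃, mul_smul]
  have e₅ : β.comp φ₂ = β.comp φ₄ := by
    apply CoalgHom.coe_linearMap_injective
    ext; simp [β, φ₂, φ₄, mul_assoc]
  have e₆ : β.comp φ₃ = α.comp φ₄ := by
    apply CoalgHom.coe_linearMap_injective
    ext; simp [α, β, φ₃, φ₄]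
  have h : pull (D := ((T ⊗[k] T) ⊗[k] T) ⊗[k] N) φ₁ (hμ.coboundHom g)
        * pull (D := ((T ⊗[k] T) ⊗[k] T) ⊗[k] N) φ₂ (hμ.coboundHom g)
      = pull (D := ((T ⊗[k] T) ⊗[k] T) ⊗[k] N) φ₃ (hμ.coboundHom g)
        * pull (D := ((T ⊗[k] T) ⊗[k] T) ⊗[k] N) φ₄ (hμ.coboundHom g) := by
    have hc : hμ.coboundHom g = pull α g * ((pull β g)⁻¹ * pull hμ.innerHom g) := rfl
    simp only [hc, map_mul, map_inv]
    have h₁ := pull_eq_of_comp_eq e₁ g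
    have h₂ := pull_eq_of_comp_eq e₂ g
    have h₃ := pull_eq_of_comp_eq e₃ g
    have h₄ := pull_eq_of_comp_eq e₄ g
    have h₅ := pull_eq_of_comp_eq e₅ g
    have h₆ := pull_eq_of_comp_eq e₆ g
    rw [h₁, h₂, h₃, h₄, h₅, h₆]
    generalize pull φ₃ (pull hμ.innerHom g) = x
    generalize pull φ₂ (pull hμ.innerHom g) = y
    generalize pull φ₃ (pull α g) = z
    generalize pull φ₄ (pull α g) = w
    apply Additive.ofMul.injective
    simp only [ofMul_mul, ofMul_inv]
    abel
  exact congrArg Reg.toLin h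

lemma pull_lT_coboundHom (hμ : IsModuleBialgebra μ) (g : Reg k (T ⊗[k] N) A)
    {χ : N ⊗[k] N →ₗc[k] N} (hχ : hμ.actHom.comp (lT T χ) = χ.comp hμ.diagHom) :
    pull (lT (T ⊗[k] T) χ) (hμ.coboundHom g)
      = pull (rT (N ⊗[k] N) (sndHom T T)) (pull (lT T χ) g)
        * ((pull (rT (N ⊗[k] N) (Bialgebra.mulCoalgHom k T)) (pull (lT T χ) g))⁻¹
          * pull hμ.innerDiagHom (pull (lT T χ) g)) := by
  rw [coboundHom_apply, map_mul, map_mul, map_inv, pull_lT_pull_rT, pull_lT_pull_rT,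
    pull_eq_of_comp_eq (hμ.innerHom_comp_lT hχ) g]

lemma pull_mul_coboundHom (hμ : IsModuleBialgebra μ) {f : Reg k (N ⊗[k] N) A}
    {g : Reg k (T ⊗[k] N) A}
    (h : stabLHS μ f.toLin f⁻¹.toLin = stabRHS g.toLin g⁻¹.toLin) :
    pull (lT (T ⊗[k] T) (Bialgebra.mulCoalgHom k N)) (hμ.coboundHom g)
      = pull (lT (T ⊗[k] T) (fstHom N N)) (hμ.coboundHom g)
        * pull (lT (T ⊗[k] T) (sndHom N N)) (hμ.coboundHom g) := by
  rw [hμ.stab_iff] at h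
  let φ₁ : (T ⊗[k] T) ⊗[k] (N ⊗[k] N) →ₗc[k] T ⊗[k] (N ⊗[k] N) := rT (N ⊗[k] N) (sndHom T T)
  let φ₂ : (T ⊗[k] T) ⊗[k] (N ⊗[k] N) →ₗc[k] T ⊗[k] (N ⊗[k] N) :=
    rT (N ⊗[k] N) (Bialgebra.mulCoalgHom k T)
  have e₁ : (sndHom T (N ⊗[k] N)).comp φ₁ = (sndHom T (N ⊗[k] N)).comp φ₂ := by
    apply CoalgHom.coe_linearMap_injective
    ext; simp [φ₁, φ₂, mul_smul]
  have e₂ : hμ.diagHom.comp φ₁ = (sndHom T (N ⊗[k] N)).comp hμ.innerDiagHom := by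
    apply CoalgHom.coe_linearMap_injective
    ext; simp [φ₁, ← TensorProduct.smul_tmul']
  have h₁ := congrArg (pull φ₁) h
  have h₂ := congrArg (pull φ₂) h
  have h₃ := congrArg (pull hμ.innerDiagHom) h
  simp only [map_mul, map_inv] at h₁ h₂ h₃
  rw [hμ.pull_lT_coboundHom g hμ.actHom_comp_lT_mul,
    hμ.pull_lT_coboundHom g hμ.fstHom_comp_diagHom.symm,
    hμ.pull_lT_coboundHom g hμ.sndHom_comp_diagHom.symm]
  rw [pull_eq_of_comp_eq e₁ f, pull_eq_of_comp_eq e₂ f] at h₁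
  rw [← pull_eq_of_comp_eq hμ.diagHom_comp_innerDiagHom f] at h₂
  exact mul_inv_mul_eq_of_mul_inv_eq h₁ h₂ h₃

lemma isMeasZ2_coboundHom (hμ : IsModuleBialgebra μ) {f : Reg k (N ⊗[k] N) A}
    {g : Reg k (T ⊗[k] N) A} (hg : IsStabilityWitness μ f.toLin f⁻¹.toLin g.toLin g⁻¹.toLin) :
    IsMeasZ2 μ (hμ.coboundHom g).toLin :=
  ⟨⟨(measures_iff _).2 ⟨hμ.pull_mul_coboundHom hg.2.2.2,
      hμ.pull_inlHom_coboundHom ((pull_inlHom_eq_one_iff g).2 hg.2.1)⟩,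
    hμ.measNormalized2_coboundHom ((pull_inrHom_eq_one_iff g).2 hg.1), _, Reg.isConvInv _⟩,
    hμ.measCocycle2_coboundHom g⟩

lemma isMeasB2_coboundHom (hμ : IsModuleBialgebra μ) {g : Reg k (T ⊗[k] N) A}
    (hm : pull (lT T (Bialgebra.mulCoalgHom k N)) g
      = pull (lT T (fstHom N N)) g * pull (lT T (sndHom N N)) g)
    (hl : pull (inlHom T N) g = 1) (hr : pull (inrHom N T) g = 1) :
    IsMeasB2 μ (hμ.coboundHom g).toLin :=
  ⟨_, _, ⟨(measures_iff g).2 ⟨hm, hl⟩, (pull_inrHom_eq_one_iff g).1 hr, _, Reg.isConvInv g⟩,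
    Reg.isConvInv g, (hμ.measCobound_toLin g).symm⟩

lemma measCohomologous2_coboundHom (hμ : IsModuleBialgebra μ) {f : Reg k (N ⊗[k] N) A}
    {g g' : Reg k (T ⊗[k] N) A}
    (hg : IsStabilityWitness μ f.toLin f⁻¹.toLin g.toLin g⁻¹.toLin)
    (hg' : IsStabilityWitness μ f.toLin f⁻¹.toLin g'.toLin g'⁻¹.toLin) :
    MeasCohomologous2 μ (hμ.coboundHom g).toLin (hμ.coboundHom g').toLin := by
  refine ⟨(hμ.coboundHom (g * g'⁻¹)).toLin, hμ.isMeasB2_coboundHom ?_ ?_ ?_, ?_⟩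
  · have h := ((hμ.stab_iff f g).1 hg.2.2.2).symm.trans ((hμ.stab_iff f g').1 hg'.2.2.2)
    simp only [map_mul, map_inv]
    exact mul_inv_eq_mul_of_mul_inv_mul_eq h
  · rw [map_mul, map_inv, (pull_inlHom_eq_one_iff g).2 hg.2.1,
      (pull_inlHom_eq_one_iff g').2 hg'.2.1, inv_one, one_mul]
  · rw [map_mul, map_inv, (pull_inrHom_eq_one_iff g).2 hg.1,
      (pull_inrHom_eq_one_iff g').2 hg'.1, inv_one, one_mul]
  · rw [← Reg.toLin_mul, ← map_mul, mul_mul_inv_cancel'_right]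

/-- The difference of the action and the trivial action on convolution-invertible maps. -/
noncomputable def twistHom (hμ : IsModuleBialgebra μ) :
    Reg k N A →* Reg k (T ⊗[k] N) A :=
  (pull (sndHom T N))⁻¹ * pull hμ.actHom

lemma twistHom_apply (hμ : IsModuleBialgebra μ) (u : Reg k N A) :
    hμ.twistHom u = (pull (sndHom T N) u)⁻¹ * pull hμ.actHom u := rfl

lemma coboundHom_twistHom (hμ : IsModuleBialgebra μ) (u : Reg k N A) :
    hμ.coboundHom (hμ.twistHom u) = 1 := by
  have e₁ : (sndHom T N).comp hμ.innerHom = hμ.actHom.comp (rT N (sndHom T T)) := by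
    apply CoalgHom.coe_linearMap_injective
    ext; simp [← TensorProduct.smul_tmul']
  have e₂ : (sndHom T N).comp (rT N (Bialgebra.mulCoalgHom k T))
      = (sndHom T N).comp (rT N (sndHom T T)) := by
    apply CoalgHom.coe_linearMap_injective
    ext; simp [mul_smul]
  rw [coboundHom_apply, twistHom_apply]
  simp only [map_mul, map_inv]
  rw [pull_eq_of_comp_eq e₁ u, pull_eq_of_comp_eq e₂ u,
    pull_eq_of_comp_eq hμ.actHom_comp_innerHom u]
  apply Additive.ofMul.injective
  simp only [ofMul_mul, ofMul_inv, ofMul_one]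
  abel

lemma pull_inlHom_twistHom (hμ : IsModuleBialgebra μ) (u : Reg k N A) :
    pull (inlHom T N) (hμ.twistHom u) = 1 := by
  have e : hμ.actHom.comp (inlHom T N) = (sndHom T N).comp (inlHom T N) := by
    apply CoalgHom.coe_linearMap_injective
    ext; simp [hμ.act_one, Algebra.algebraMap_eq_smul_one]
  rw [twistHom_apply, map_mul, map_inv, pull_eq_of_comp_eq e u, inv_mul_cancel]

lemma pull_inrHom_twistHom (hμ : IsModuleBialgebra μ) (u : Reg k N A) :
    pull (inrHom N T) (hμ.twistHom u) = 1 := by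
  have e : hμ.actHom.comp (inrHom N T) = (sndHom T N).comp (inrHom N T) := by
    apply CoalgHom.coe_linearMap_injective
    ext; simp [hμ.one_act]
  rw [twistHom_apply, map_mul, map_inv, pull_eq_of_comp_eq e u, inv_mul_cancel]

lemma pull_lT_twistHom (hμ : IsModuleBialgebra μ) (u : Reg k N A)
    {χ : N ⊗[k] N →ₗc[k] N} (hχ : hμ.actHom.comp (lT T χ) = χ.comp hμ.diagHom) :
    pull (lT T χ) (hμ.twistHom u)
      = (pull (sndHom T (N ⊗[k] N)) (pull χ u))⁻¹ * pull hμ.diagHom (pull χ u) := by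
  rw [twistHom_apply, map_mul, map_inv, pull_lT_pull_sndHom,
    pull_eq_of_comp_eq hχ u]

lemma isMeasB2_coboundHom_of_isB2 (hμ : IsModuleBialgebra μ) {f : Reg k (N ⊗[k] N) A}
    {g : Reg k (T ⊗[k] N) A} (hf : IsB2 f.toLin)
    (hg : IsStabilityWitness μ f.toLin f⁻¹.toLin g.toLin g⁻¹.toLin) :
    IsMeasB2 μ (hμ.coboundHom g).toLin := by
  obtain ⟨t, tinv, -, ht, hft⟩ := hf
  let u : Reg k N A := ht.toReg
  have hfu : f = pull (sndHom N N) u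
      * ((pull (Bialgebra.mulCoalgHom k N) u)⁻¹ * pull (fstHom N N) u) := Reg.ext_toLin hft
  have h := (hμ.stab_iff f g).1 hg.2.2.2
  rw [hfu] at h
  simp only [map_mul, map_inv] at h
  rw [← mul_one (hμ.coboundHom g), ← hμ.coboundHom_twistHom u, ← map_mul]
  refine hμ.isMeasB2_coboundHom ?_ ?_ ?_
  · rw [map_mul, map_mul, map_mul, hμ.pull_lT_twistHom u hμ.actHom_comp_lT_mul,
      hμ.pull_lT_twistHom u hμ.fstHom_comp_diagHom.symm,
      hμ.pull_lT_twistHom u hμ.sndHom_comp_diagHom.symm]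
    exact mul_inv_mul_eq_of_mul_inv_mul_eq h
  · rw [map_mul, pull_inlHom_twistHom, mul_one, (pull_inlHom_eq_one_iff g).2 hg.2.1]
  · rw [map_mul, pull_inrHom_twistHom, mul_one, (pull_inrHom_eq_one_iff g).2 hg.1]

end IsModuleBialgebra

end Action

end SmashPaper

/-- **The homomorphism `d : H²(N,A)^T → H²_meas(T, Hom(N,A))`.**
Let `N` and `T` be cocommutative Hopf algebras over `k` with `N` a `T`-module bialgebra,
and `A` a commutative `k`-algebra with trivial action.  For a Sweedler 2-cocycle `f` on
`N` whose class is `T`-stable with stability witness `g : T ⊗ N → A`, the cochain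
`(t⊗t')(n) ↦ ∑ g(t'₍₁₎⊗n₍₁₎) g⁻¹(t₍₁₎t'₍₂₎⊗n₍₂₎) g(t₍₂₎⊗t'₍₃₎(n₍₃₎))`
(which is `measCobound μ g ginv`) is a measuring 2-cocycle; for two stability witnesses
of the same `f` the resulting measuring 2-cocycles differ by a measuring 2-coboundary;
if `f` is a Sweedler 2-coboundary on `N` then the result is a measuring 2-coboundary;
and the assignment is compatible with convolution products.  Hence it defines a group
homomorphism `d : H²(N,A)^T → H²_meas(T,Hom(N,A))`. -/
theorem d_well_defined
    {k : Type} [Field k] {T N A : Type}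
    [Ring T] [HopfAlgebra k T] [Ring N] [HopfAlgebra k N]
    [CommRing A] [Algebra k A]
    (hTcc : IsCocomm k T) (hNcc : IsCocomm k N)
    (μ : T ⊗[k] N →ₗ[k] N) (hμ : IsModuleBialgebra μ) :
    -- `d f` is a measuring 2-cocycle
    (∀ (f finv : N ⊗[k] N →ₗ[k] A) (g ginv : T ⊗[k] N →ₗ[k] A),
      IsZ2 f → IsConvInv f finv → IsStabilityWitness μ f finv g ginv →
        IsMeasZ2 μ (measCobound μ g ginv))
    -- witness independence
    ∧ (∀ (f finv : N ⊗[k] N →ₗ[k] A) (g ginv g' ginv' : T ⊗[k] N →ₗ[k] A),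
        IsZ2 f → IsConvInv f finv →
        IsStabilityWitness μ f finv g ginv → IsStabilityWitness μ f finv g' ginv' →
          MeasCohomologous2 μ (measCobound μ g ginv) (measCobound μ g' ginv'))
    -- coboundaries map to measuring coboundaries
    ∧ (∀ (f finv : N ⊗[k] N →ₗ[k] A) (g ginv : T ⊗[k] N →ₗ[k] A),
        IsB2 f → IsConvInv f finv → IsStabilityWitness μ f finv g ginv →
          IsMeasB2 μ (measCobound μ g ginv))
    -- compatibility with products (so that `d` is a group homomorphism)
    ∧ (∀ (f finv f' finv' : N ⊗[k] N →ₗ[k] A) (g ginv g' ginv' : T ⊗[k] N →ₗ[k] A),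
        IsZ2 f → IsConvInv f finv → IsStabilityWitness μ f finv g ginv →
        IsZ2 f' → IsConvInv f' finv' → IsStabilityWitness μ f' finv' g' ginv' →
          measCobound μ (conv g g') (conv ginv ginv')
            = conv (measCobound μ g ginv) (measCobound μ g' ginv')) := by
  have : Coalgebra.IsCocomm k T := ⟨hTcc⟩
  have : Coalgebra.IsCocomm k N := ⟨hNcc⟩
  refine ⟨fun f finv g ginv _ hf hg => ?_, fun f finv g ginv g' ginv' _ hf hg hg' => ?_,
    fun f finv g ginv hB hf hg => ?_, fun f finv f' finv' g ginv g' ginv' _ _ hg _ _ hg' => ?_⟩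
  · exact hμ.isMeasZ2_coboundHom (f := hf.toReg) (g := hg.2.2.1.toReg) hg
  · exact hμ.measCohomologous2_coboundHom (f := hf.toReg) (g := hg.2.2.1.toReg)
      (g' := hg'.2.2.1.toReg) hg hg'
  · exact hμ.isMeasB2_coboundHom_of_isB2 (f := hf.toReg) (g := hg.2.2.1.toReg) hB hg
  · have h := congrArg Reg.toLin (map_mul hμ.coboundHom hg.2.2.1.toReg hg'.2.2.1.toReg)
    rw [← hμ.measCobound_toLin, mul_inv] at h
    exact h
end

section
/- Let H = N⋊T be the smash product of cocommutative Hopf algebras N and T over a field k, acting trivially on the commutative k-algebra A. For every measuring 2-cocycle f ∈ Z²_meas(T,Hom(N,A)), the map jf: H⊗H⊗H → A defined by jf((n⋊t)⊗(n'⋊t')⊗(n''⋊t'')) = ε(n)ε(n') f(t⊗t')(n'') ε(t'') is a Sweedler 3-cocycle on H whose restriction to T⊗T⊗T is trivial; and if f is a measuring 2-coboundary then jf is a Sweedler 3-coboundary. Hence j induces a group homomorphism H²_meas(T,Hom(N,A)) → H̃³(H,A). -/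
open TensorProduct

open TensorProduct SmashPaper

namespace SmashPaper

section Convolution

variable {k : Type} [Field k] {C D A : Type} [AddCommGroup C] [Module k C] [Coalgebra k C]
  [AddCommGroup D] [Module k D] [Coalgebra k D] [CommRing A] [Algebra k A]

theorem toConv_conv (f g : C →ₗ[k] A) :
    WithConv.toConv (conv f g) = WithConv.toConv f * WithConv.toConv g := rfl

theorem toConv_convOne : WithConv.toConv (convOne C A : C →ₗ[k] A) = 1 := rfl

theorem conv_comp_coalgHom (f g : D →ₗ[k] A) (Φ : C →ₗc[k] D) :
    conv (f ∘ₗ Φ.toLinearMap) (g ∘ₗ Φ.toLinearMap) = conv f g ∘ₗ Φ.toLinearMap :=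
  congrArg WithConv.ofConv rfl |>.trans
    (LinearMap.convMul_comp_coalgHom_distrib (WithConv.toConv f) (WithConv.toConv g) Φ).symm

theorem convOne_comp_coalgHom (Φ : C →ₗc[k] D) :
    (convOne D A : D →ₗ[k] A) ∘ₗ Φ.toLinearMap = convOne C A := by
  ext x
  simp [convOne]

theorem conv_assoc (f g h : C →ₗ[k] A) : conv (conv f g) h = conv f (conv g h) :=
  WithConv.toConv_injective (by simp only [toConv_conv, mul_assoc])

theorem IsConvInv.comp_coalgHom {f g : D →ₗ[k] A} (h : IsConvInv f g) (Φ : C →ₗc[k] D) :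
    IsConvInv (f ∘ₗ Φ.toLinearMap) (g ∘ₗ Φ.toLinearMap) := by
  constructor
  · rw [conv_comp_coalgHom, h.1, convOne_comp_coalgHom]
  · rw [conv_comp_coalgHom, h.2, convOne_comp_coalgHom]

end Convolution

section Drop

variable {k : Type} [Field k] {C D : Type} [AddCommGroup C] [Module k C]
  [AddCommGroup D] [Module k D]

@[simp]
theorem dropL_tmul [Coalgebra k C] (c : C) (d : D) :
    dropL (k := k) C D (c ⊗ₜ[k] d) = Coalgebra.counit (R := k) c • d := rfl

@[simp]
theorem dropR_tmul [Coalgebra k D] (c : C) (d : D) :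
    dropR (k := k) C D (c ⊗ₜ[k] d) = Coalgebra.counit (R := k) d • c := by
  simp [dropR]

/-- `dropL` as a morphism of coalgebras. -/
noncomputable def dropLCoalgHom (C D : Type) [AddCommGroup C] [Module k C] [Coalgebra k C]
    [AddCommGroup D] [Module k D] [Coalgebra k D] : C ⊗[k] D →ₗc[k] D :=
  (Coalgebra.TensorProduct.lid k D : k ⊗[k] D →ₗc[k] D).comp
    (Coalgebra.TensorProduct.map (Coalgebra.counitCoalgHom k C) (CoalgHom.id k D))

/-- `dropR` as a morphism of coalgebras. -/
noncomputable def dropRCoalgHom (C D : Type) [AddCommGroup C] [Module k C] [Coalgebra k C]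
    [AddCommGroup D] [Module k D] [Coalgebra k D] : C ⊗[k] D →ₗc[k] C :=
  (Coalgebra.TensorProduct.rid k k C : C ⊗[k] k →ₗc[k] C).comp
    (Coalgebra.TensorProduct.map (CoalgHom.id k C) (Coalgebra.counitCoalgHom k D))

variable [Coalgebra k C] [Coalgebra k D]

@[simp]
theorem dropLCoalgHom_tmul (c : C) (d : D) :
    dropLCoalgHom (k := k) C D (c ⊗ₜ[k] d) = Coalgebra.counit (R := k) c • d := rfl

@[simp]
theorem dropRCoalgHom_tmul (c : C) (d : D) :
    dropRCoalgHom (k := k) C D (c ⊗ₜ[k] d) = Coalgebra.counit (R := k) d • c := by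
  simp [dropRCoalgHom]

end Drop

section Action

variable {k : Type} [Field k] {T N : Type} [Ring T] [Bialgebra k T] [Ring N] [Bialgebra k N]
  {μ : T ⊗[k] N →ₗ[k] N}

/-- The action of a module bialgebra as a morphism of coalgebras. -/
noncomputable def IsModuleBialgebra.coalgHom (h : IsModuleBialgebra μ) : T ⊗[k] N →ₗc[k] N where
  toLinearMap := μ
  counit_comp := by
    ext t n
    simp [h.counit_act, mul_comm]
  map_comp_comul := h.comul_act.symm

@[simp]
theorem IsModuleBialgebra.coalgHom_apply (h : IsModuleBialgebra μ) (x : T ⊗[k] N) :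
    h.coalgHom x = μ x := rfl

theorem dropLCoalgHom_smashCross (h : IsModuleBialgebra μ) (t : T) (n : N) :
    dropLCoalgHom (k := k) N T (smashCross μ (t ⊗ₜ n)) = Coalgebra.counit (R := k) n • t := by
  have key (w : T ⊗[k] T) : dropLCoalgHom (k := k) N T (TensorProduct.map μ LinearMap.id
      ((TensorProduct.assoc k T N T).symm (LinearMap.lTensor T (TensorProduct.comm k T N).toLinearMap
        (TensorProduct.assoc k T T N (w ⊗ₜ n))))) =
      Coalgebra.counit (R := k) n • dropLCoalgHom (k := k) T T w := by
    induction w with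
    | zero => simp
    | add x y hx hy => simp only [add_tmul, map_add, hx, hy, smul_add]
    | tmul a b => simp [h.counit_act, smul_smul, mul_comm]
  refine (key _).trans (congrArg _ ?_)
  exact (congrArg (TensorProduct.lid k T) (Coalgebra.rTensor_counit_comul t)).trans (by simp)

theorem dropRCoalgHom_smashCross (t : T) (n : N) :
    dropRCoalgHom (k := k) N T (smashCross μ (t ⊗ₜ n)) = μ (t ⊗ₜ n) := by
  have key (w : T ⊗[k] T) : dropRCoalgHom (k := k) N T (TensorProduct.map μ LinearMap.id
      ((TensorProduct.assoc k T N T).symm (LinearMap.lTensor T (TensorProduct.comm k T N).toLinearMap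
        (TensorProduct.assoc k T T N (w ⊗ₜ n))))) = μ (dropRCoalgHom (k := k) T T w ⊗ₜ n) := by
    induction w with
    | zero => simp
    | add x y hx hy => simp only [add_tmul, map_add, hx, hy]
    | tmul a b => simp [← smul_tmul']
  refine (key _).trans (congrArg (fun s => μ (s ⊗ₜ n)) ?_)
  exact (congrArg (TensorProduct.rid k T) (Coalgebra.lTensor_counit_comul t)).trans (by simp)

end Action

namespace IsSmashProduct

variable {k : Type} [Field k] {T N H A : Type} [Ring T] [Bialgebra k T] [Ring N] [Bialgebra k N]
  [Ring H] [Bialgebra k H] [CommRing A] [Algebra k A]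
  {μ : T ⊗[k] N →ₗ[k] N} {iN : N →ₐc[k] H} {iT : T →ₐc[k] H}

/-- The coalgebra isomorphism `n ⊗ t ↦ n ⋊ t`. -/
noncomputable def equiv (h : IsSmashProduct μ iN iT) : N ⊗[k] T ≃ₗc[k] H :=
  CoalgEquiv.ofBijective
    (f := (Bialgebra.mulCoalgHom k H).comp
      (Coalgebra.TensorProduct.map (iN : N →ₗc[k] H) (iT : T →ₗc[k] H))) h.bij

@[simp]
theorem equiv_tmul (h : IsSmashProduct μ iN iT) (n : N) (t : T) :
    h.equiv (n ⊗ₜ t) = iN n * iT t := rfl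

@[simp]
theorem equiv_symm_mul (h : IsSmashProduct μ iN iT) (n : N) (t : T) :
    h.equiv.symm (iN n * iT t) = n ⊗ₜ t :=
  h.equiv.symm_apply_apply (n ⊗ₜ t)

@[elab_as_elim]
theorem induction (h : IsSmashProduct μ iN iT) {P : H → Prop} (x : H)
    (mul : ∀ n t, P (iN n * iT t)) (add : ∀ x y, P x → P y → P (x + y)) : P x := by
  obtain ⟨u, rfl⟩ := h.bij.2 x
  induction u with
  | zero => simpa using mul 0 0
  | add x y hx hy => simpa only [map_add] using add _ _ hx hy
  | tmul n t => exact mul n t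

/-- The projection `n ⋊ t ↦ ε(n) t`. -/
noncomputable def projT (h : IsSmashProduct μ iN iT) : H →ₗc[k] T :=
  (dropLCoalgHom N T).comp (h.equiv.symm : H →ₗc[k] N ⊗[k] T)

/-- The projection `n ⋊ t ↦ ε(t) n`. -/
noncomputable def projN (h : IsSmashProduct μ iN iT) : H →ₗc[k] N :=
  (dropRCoalgHom N T).comp (h.equiv.symm : H →ₗc[k] N ⊗[k] T)

@[simp]
theorem projT_incl_mul (h : IsSmashProduct μ iN iT) (n : N) (t : T) :
    h.projT (iN n * iT t) = Coalgebra.counit (R := k) n • t := by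
  simp [projT]

@[simp]
theorem projN_incl_mul (h : IsSmashProduct μ iN iT) (n : N) (t : T) :
    h.projN (iN n * iT t) = Coalgebra.counit (R := k) t • n := by
  simp [projN]

theorem incl_mul_incl (h : IsSmashProduct μ iN iT) (t : T) (n : N) :
    iT t * iN n = h.equiv (smashCross μ (t ⊗ₜ n)) :=
  LinearMap.congr_fun h.straighten (t ⊗ₜ n)

theorem projT_mul (h : IsSmashProduct μ iN iT) (x y : H) :
    h.projT (x * y) = h.projT x * h.projT y := by
  have key (n : N) (t : T) (u : N ⊗[k] T) : h.projT (iN n * h.equiv u * iT t) =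
      Coalgebra.counit (R := k) n • (dropLCoalgHom N T u * t) := by
    induction u with
    | zero => simp
    | add x y hx hy => simp only [map_add, mul_add, add_mul, hx, hy, smul_add]
    | tmul a b =>
      rw [equiv_tmul, ← mul_assoc, mul_assoc, ← map_mul, ← map_mul, projT_incl_mul]
      simp [smul_smul]
  induction x using h.induction with
  | add x x' hx hx' => simp only [add_mul, map_add, hx, hx']
  | mul n t =>
    induction y using h.induction with
    | add y y' hy hy' => simp only [mul_add, map_add, hy, hy']
    | mul n' t' =>
      rw [mul_assoc, ← mul_assoc (iT t), h.incl_mul_incl, ← mul_assoc, key,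
        dropLCoalgHom_smashCross h.act]
      simp [smul_smul, mul_comm]

/-- `x ⊗ y ↦ ∑ πN(x₍₁₎) ⊗ πT(x₍₂₎)(πN(y))`, which factors `πN(xy)` through the
multiplication of `N`. -/
noncomputable def mulFactor (h : IsSmashProduct μ iN iT) : H ⊗[k] H →ₗc[k] N ⊗[k] N :=
  (Coalgebra.TensorProduct.map (CoalgHom.id k N) h.act.coalgHom).comp
    ((Coalgebra.TensorProduct.assoc k k N T N : _ →ₗc[k] _).comp
      (Coalgebra.TensorProduct.map (h.equiv.symm : H →ₗc[k] N ⊗[k] T) h.projN))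

@[simp]
theorem mulFactor_incl_mul (h : IsSmashProduct μ iN iT) (n : N) (t : T) (y : H) :
    h.mulFactor ((iN n * iT t) ⊗ₜ y) = n ⊗ₜ μ (t ⊗ₜ h.projN y) := by
  simp [mulFactor]

theorem projN_mul (h : IsSmashProduct μ iN iT) (x y : H) :
    h.projN (x * y) = LinearMap.mul' k N (h.mulFactor (x ⊗ₜ y)) := by
  have key (n : N) (t : T) (u : N ⊗[k] T) : h.projN (iN n * h.equiv u * iT t) =
      Coalgebra.counit (R := k) t • (n * dropRCoalgHom N T u) := by
    induction u with
    | zero => simp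
    | add x y hx hy => simp only [map_add, mul_add, add_mul, hx, hy, smul_add]
    | tmul a b =>
      rw [equiv_tmul, ← mul_assoc, mul_assoc, ← map_mul, ← map_mul, projN_incl_mul]
      simp [smul_smul, mul_comm]
  induction x using h.induction with
  | add x x' hx hx' => simp only [add_mul, map_add, add_tmul, hx, hx']
  | mul n t =>
    induction y using h.induction with
    | add y y' hy hy' => simp only [mul_add, map_add, tmul_add, hy, hy']
    | mul n' t' =>
      rw [mul_assoc, ← mul_assoc (iT t), h.incl_mul_incl, ← mul_assoc, key,
        dropRCoalgHom_smashCross]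
      simp

theorem dropR_mulFactor (h : IsSmashProduct μ iN iT) (x y : H) :
    dropR N N (h.mulFactor (x ⊗ₜ y)) = Coalgebra.counit (R := k) y • h.projN x := by
  induction x using h.induction with
  | add x x' hx hx' => simp only [map_add, add_tmul, hx, hx', smul_add]
  | mul n t => simp [h.act.counit_act, smul_smul, mul_comm]

theorem dropL_mulFactor (h : IsSmashProduct μ iN iT) (x y : H) :
    dropL N N (h.mulFactor (x ⊗ₜ y)) = μ (h.projT x ⊗ₜ h.projN y) := by
  induction x using h.induction with
  | add x x' hx hx' => simp only [map_add, add_tmul, hx, hx']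
  | mul n t => simp [← smul_tmul']

theorem isCocomm (h : IsSmashProduct μ iN iT) (hT : IsCocomm k T) (hN : IsCocomm k N) :
    Coalgebra.IsCocomm k H := by
  have : Coalgebra.IsCocomm k T := ⟨hT⟩
  have : Coalgebra.IsCocomm k N := ⟨hN⟩
  refine ⟨LinearMap.ext fun x => ?_⟩
  obtain ⟨u, rfl⟩ := h.equiv.surjective x
  have hu : Coalgebra.comul (h.equiv u) =
      TensorProduct.map h.equiv.toLinearMap h.equiv.toLinearMap (Coalgebra.comul (R := k) u) :=
    (CoalgHomClass.map_comp_comul_apply h.equiv u).symm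
  change TensorProduct.comm k H H (Coalgebra.comul (h.equiv u)) = Coalgebra.comul (h.equiv u)
  rw [hu, ← TensorProduct.map_comm, Coalgebra.comm_comul]

/-- `x ⊗ y ↦ πT(x) ⊗ πN(y)`. -/
noncomputable def proj2 (h : IsSmashProduct μ iN iT) : H ⊗[k] H →ₗc[k] T ⊗[k] N :=
  Coalgebra.TensorProduct.map h.projT h.projN

/-- `x ⊗ y ⊗ z ↦ πT(x) ⊗ πT(y) ⊗ πN(z)`. -/
noncomputable def proj3 (h : IsSmashProduct μ iN iT) :
    (H ⊗[k] H) ⊗[k] H →ₗc[k] (T ⊗[k] T) ⊗[k] N :=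
  Coalgebra.TensorProduct.map (Coalgebra.TensorProduct.map h.projT h.projT) h.projN

/-- `x ⊗ y ⊗ z ⊗ w ↦ πT(x) ⊗ πT(y) ⊗ πT(z) ⊗ πN(w)`. -/
noncomputable def proj4 (h : IsSmashProduct μ iN iT) :
    ((H ⊗[k] H) ⊗[k] H) ⊗[k] H →ₗc[k] ((T ⊗[k] T) ⊗[k] T) ⊗[k] N :=
  Coalgebra.TensorProduct.map (Coalgebra.TensorProduct.map
    (Coalgebra.TensorProduct.map h.projT h.projT) h.projT) h.projN

@[simp]
theorem proj2_tmul (h : IsSmashProduct μ iN iT) (x y : H) :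
    h.proj2 (x ⊗ₜ y) = h.projT x ⊗ₜ h.projN y := rfl

@[simp]
theorem proj3_tmul (h : IsSmashProduct μ iN iT) (x y z : H) :
    h.proj3 ((x ⊗ₜ y) ⊗ₜ z) = (h.projT x ⊗ₜ h.projT y) ⊗ₜ h.projN z := rfl

@[simp]
theorem proj4_tmul (h : IsSmashProduct μ iN iT) (x y z w : H) :
    h.proj4 (((x ⊗ₜ y) ⊗ₜ z) ⊗ₜ w) =
      ((h.projT x ⊗ₜ h.projT y) ⊗ₜ h.projT z) ⊗ₜ h.projN w := rfl

@[simp]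
theorem projT_one (h : IsSmashProduct μ iN iT) : h.projT 1 = 1 := by
  simpa using h.projT_incl_mul 1 1

@[simp]
theorem projN_one (h : IsSmashProduct μ iN iT) : h.projN 1 = 1 := by
  simpa using h.projN_incl_mul 1 1

@[simp]
theorem projT_incl (h : IsSmashProduct μ iN iT) (t : T) : h.projT (iT t) = t := by
  simpa using h.projT_incl_mul 1 t

@[simp]
theorem projN_incl (h : IsSmashProduct μ iN iT) (t : T) :
    h.projN (iT t) = algebraMap k N (Coalgebra.counit t) := by
  simpa [Algebra.algebraMap_eq_smul_one] using h.projN_incl_mul 1 t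

theorem jOf_proj3 (h : IsSmashProduct μ iN iT) (f : (T ⊗[k] T) ⊗[k] N →ₗ[k] A) :
    JOf iN iT f (f ∘ₗ h.proj3.toLinearMap) := by
  intro n t n' t' n'' t''
  change f ((h.projT (iN n * iT t) ⊗ₜ h.projT (iN n' * iT t')) ⊗ₜ h.projN (iN n'' * iT t'')) = _
  simp only [projT_incl_mul, projN_incl_mul, ← smul_tmul', tmul_smul, map_smul, smul_smul]
  rw [← Algebra.smul_def]
  congr 1
  ring

theorem eq_comp_proj3 (h : IsSmashProduct μ iN iT) {f : (T ⊗[k] T) ⊗[k] N →ₗ[k] A}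
    {J : (H ⊗[k] H) ⊗[k] H →ₗ[k] A} (hJ : JOf iN iT f J) : J = f ∘ₗ h.proj3.toLinearMap := by
  ext x y z
  change J ((x ⊗ₜ y) ⊗ₜ z) = (f ∘ₗ h.proj3.toLinearMap) ((x ⊗ₜ y) ⊗ₜ z)
  induction x using h.induction with
  | add x x' hx hx' => simp only [add_tmul, map_add, hx, hx']
  | mul n t =>
    induction y using h.induction with
    | add y y' hy hy' => simp only [add_tmul, tmul_add, map_add, hy, hy']
    | mul n' t' =>
      induction z using h.induction with
      | add z z' hz hz' => simp only [tmul_add, map_add, hz, hz']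
      | mul n'' t'' => rw [hJ, h.jOf_proj3]

theorem isZ3 (h : IsSmashProduct μ iN iT) [Coalgebra.IsCocomm k H]
    {f : (T ⊗[k] T) ⊗[k] N →ₗ[k] A} (hf : IsMeasZ2 μ f) : IsZ3 (f ∘ₗ h.proj3.toLinearMap) := by
  obtain ⟨⟨⟨hmeas, hone⟩, hnorm, finv, hinv⟩, hcoc⟩ := hf
  refine ⟨fun x y => ⟨?_, ?_, ?_⟩, ⟨_, hinv.comp_coalgHom h.proj3⟩, ?_⟩
  · simp [(hnorm _ _).1]
  · simp [(hnorm _ _).2]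
  · simp [hone, mul_comm]
  · let Ω : ((H ⊗[k] H) ⊗[k] H) ⊗[k] H →ₗc[k] (T ⊗[k] T) ⊗[k] (N ⊗[k] N) :=
      (Coalgebra.TensorProduct.map (Coalgebra.TensorProduct.map h.projT h.projT) h.mulFactor).comp
        (Coalgebra.TensorProduct.assoc k k (H ⊗[k] H) H H : _ →ₗc[k] _)
    have hΩ (x y z w : H) : Ω (((x ⊗ₜ y) ⊗ₜ z) ⊗ₜ w) =
        (h.projT x ⊗ₜ h.projT y) ⊗ₜ h.mulFactor (z ⊗ₜ w) := rfl
    have e₁ : (f ∘ₗ h.proj3.toLinearMap) ∘ₗ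
          LinearMap.rTensor H (LinearMap.rTensor H (dropL H H)) =
        (f ∘ₗ LinearMap.rTensor N (LinearMap.rTensor T (dropL T T))) ∘ₗ h.proj4.toLinearMap := by
      ext x y z w
      simp [← smul_tmul']
    have e₂ : (f ∘ₗ h.proj3.toLinearMap) ∘ₗ LinearMap.rTensor H (m23 (H := H)) =
        (f ∘ₗ LinearMap.rTensor N ((LinearMap.lTensor T (LinearMap.mul' k T)
          ∘ₗ (TensorProduct.assoc k T T T).toLinearMap :
            (T ⊗[k] T) ⊗[k] T →ₗ[k] T ⊗[k] T))) ∘ₗ h.proj4.toLinearMap := by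
      ext x y z w
      simp [m23, projT_mul]
    have e₃ : (f ∘ₗ h.proj3.toLinearMap) ∘ₗ dropR ((H ⊗[k] H) ⊗[k] H) H =
        (f ∘ₗ LinearMap.lTensor (T ⊗[k] T) (dropR N N)) ∘ₗ Ω.toLinearMap := by
      ext x y z w
      simp [hΩ, dropR_mulFactor]
    have e₄ : (f ∘ₗ h.proj3.toLinearMap) ∘ₗ
          LinearMap.rTensor H (LinearMap.rTensor H (LinearMap.mul' k H)) =
        (f ∘ₗ LinearMap.rTensor N (LinearMap.rTensor T (LinearMap.mul' k T))) ∘ₗ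
          h.proj4.toLinearMap := by
      ext x y z w
      simp [projT_mul]
    have e₅ : (f ∘ₗ h.proj3.toLinearMap) ∘ₗ (LinearMap.lTensor (H ⊗[k] H) (LinearMap.mul' k H)
          ∘ₗ (TensorProduct.assoc k (H ⊗[k] H) H H).toLinearMap :
            ((H ⊗[k] H) ⊗[k] H) ⊗[k] H →ₗ[k] (H ⊗[k] H) ⊗[k] H) =
        (f ∘ₗ LinearMap.lTensor (T ⊗[k] T) (LinearMap.mul' k N)) ∘ₗ Ω.toLinearMap := by
      ext x y z w
      simp [hΩ, projN_mul]
    have e₆ : (f ∘ₗ LinearMap.lTensor (T ⊗[k] T) (dropL N N)) ∘ₗ Ω.toLinearMap =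
        (f ∘ₗ (LinearMap.lTensor (T ⊗[k] T) μ ∘ₗ
          (TensorProduct.assoc k (T ⊗[k] T) T N).toLinearMap :
            ((T ⊗[k] T) ⊗[k] T) ⊗[k] N →ₗ[k] (T ⊗[k] T) ⊗[k] N)) ∘ₗ h.proj4.toLinearMap := by
      ext x y z w
      simp [hΩ, dropL_mulFactor]
    unfold MeasCocycle2 at hcoc
    have e₇ := conv_comp_coalgHom (C := ((H ⊗[k] H) ⊗[k] H) ⊗[k] H)
      (f ∘ₗ LinearMap.lTensor (T ⊗[k] T) (dropR N N))
      (f ∘ₗ LinearMap.lTensor (T ⊗[k] T) (dropL N N)) Ω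
    have e₈ := congrArg (· ∘ₗ h.proj4.toLinearMap) hcoc
    simp only [← conv_comp_coalgHom (C := ((H ⊗[k] H) ⊗[k] H) ⊗[k] H)
      (D := ((T ⊗[k] T) ⊗[k] T) ⊗[k] N)] at e₈
    rw [IsZ3cond, e₁, e₂, e₃, e₄, e₅, hmeas, ← e₇, e₆, ← conv_assoc, ← e₈]
    apply WithConv.toConv_injective
    simp only [toConv_conv]
    ring

theorem isB3 (h : IsSmashProduct μ iN iT) [Coalgebra.IsCocomm k H]
    {f : (T ⊗[k] T) ⊗[k] N →ₗ[k] A} (hf : IsMeasB2 μ f) : IsB3 (f ∘ₗ h.proj3.toLinearMap) := by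
  obtain ⟨g, ginv, ⟨⟨hmeas, hone⟩, hnorm, -⟩, hinv, rfl⟩ := hf
  refine ⟨g ∘ₗ h.proj2.toLinearMap, ginv ∘ₗ h.proj2.toLinearMap, fun x => ⟨?_, ?_⟩,
    hinv.comp_coalgHom h.proj2, ?_⟩
  · simp [hnorm _]
  · simp [hone]
  · let Ω : (H ⊗[k] H) ⊗[k] H →ₗc[k] T ⊗[k] (N ⊗[k] N) :=
      (Coalgebra.TensorProduct.map h.projT h.mulFactor).comp
        (Coalgebra.TensorProduct.assoc k k H H H : _ →ₗc[k] _)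
    have hΩ (x y z : H) : Ω ((x ⊗ₜ y) ⊗ₜ z) = h.projT x ⊗ₜ h.mulFactor (y ⊗ₜ z) := rfl
    let Θ : (H ⊗[k] H) ⊗[k] H →ₗc[k] T ⊗[k] N := h.proj2.comp (dropRCoalgHom (H ⊗[k] H) H)
    have hΘ (x y z : H) : Θ ((x ⊗ₜ y) ⊗ₜ z) =
        Coalgebra.counit (R := k) z • h.projT x ⊗ₜ h.projN y := by
      simp [Θ]
    have e₁ : (g ∘ₗ h.proj2.toLinearMap) ∘ₗ p23 (H := H) =
        (g ∘ₗ LinearMap.rTensor N (dropL T T)) ∘ₗ h.proj3.toLinearMap := by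
      ext x y z
      simp [p23, ← smul_tmul']
    have e₂ : (ginv ∘ₗ h.proj2.toLinearMap) ∘ₗ LinearMap.rTensor H (LinearMap.mul' k H) =
        (ginv ∘ₗ LinearMap.rTensor N (LinearMap.mul' k T)) ∘ₗ h.proj3.toLinearMap := by
      ext x y z
      simp [projT_mul]
    have e₃ : (g ∘ₗ h.proj2.toLinearMap) ∘ₗ m23 (H := H) =
        (g ∘ₗ LinearMap.lTensor T (LinearMap.mul' k N)) ∘ₗ Ω.toLinearMap := by
      ext x y z
      simp [m23, hΩ, projN_mul]
    have e₄ : (ginv ∘ₗ h.proj2.toLinearMap) ∘ₗ dropR (H ⊗[k] H) H = ginv ∘ₗ Θ.toLinearMap := by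
      ext x y z
      simp [hΘ]
    have e₅ : (g ∘ₗ LinearMap.lTensor T (dropR N N)) ∘ₗ Ω.toLinearMap = g ∘ₗ Θ.toLinearMap := by
      ext x y z
      simp [hΩ, hΘ, dropR_mulFactor]
    have e₆ : (g ∘ₗ LinearMap.lTensor T (dropL N N)) ∘ₗ Ω.toLinearMap =
        (g ∘ₗ LinearMap.lTensor T μ ∘ₗ (TensorProduct.assoc k T T N).toLinearMap) ∘ₗ
          h.proj3.toLinearMap := by
      ext x y z
      simp [hΩ, dropL_mulFactor]
    have hcancel := congrArg WithConv.toConv (hinv.comp_coalgHom Θ).1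
    rw [toConv_conv, toConv_convOne] at hcancel
    rw [cobound3, measCobound, e₁, e₂, e₃, e₄, hmeas, ← conv_comp_coalgHom _ _ Ω, e₅, e₆,
      ← conv_comp_coalgHom, ← conv_comp_coalgHom]
    apply WithConv.toConv_injective
    simp only [toConv_conv]
    rw [mul_right_comm, hcancel, one_mul]

end IsSmashProduct

end SmashPaper

/-- **The homomorphism `j : H²_meas(T,Hom(N,A)) → H̃³(H,A)`.**
Let `H = N ⋊ T` (cocommutative Hopf algebras over `k`) act trivially on the commutative
`k`-algebra `A`.  For every measuring 2-cocycle `f`, the 3-cochain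
`jf((n⋊t) ⊗ (n'⋊t') ⊗ (n''⋊t'')) = ε(n)ε(n') f(t⊗t')(n'') ε(t'')` on `H`
(such a cochain exists and is characterized by these values) is a Sweedler 3-cocycle
whose restriction to `T ⊗ T ⊗ T` is trivial; if `f` is a measuring 2-coboundary then
`jf` is a Sweedler 3-coboundary; and `j` is compatible with convolution products.
Hence `j` induces a group homomorphism `H²_meas(T,Hom(N,A)) → H̃³(H,A)`. -/
theorem j_well_defined
    {k : Type} [Field k] {T N H A : Type}
    [Ring T] [HopfAlgebra k T] [Ring N] [HopfAlgebra k N]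
    [Ring H] [HopfAlgebra k H] [CommRing A] [Algebra k A]
    (hTcc : IsCocomm k T) (hNcc : IsCocomm k N)
    (μ : T ⊗[k] N →ₗ[k] N) (iN : N →ₐc[k] H) (iT : T →ₐc[k] H)
    (hsmash : IsSmashProduct μ iN iT) :
    -- existence of `jf`
    (∀ f : (T ⊗[k] T) ⊗[k] N →ₗ[k] A, ∃ J, JOf iN iT f J)
    -- `jf` is a 3-cocycle, trivial on `T ⊗ T ⊗ T`
    ∧ (∀ (f : (T ⊗[k] T) ⊗[k] N →ₗ[k] A) (J : (H ⊗[k] H) ⊗[k] H →ₗ[k] A),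
        IsMeasZ2 μ f → JOf iN iT f J →
          IsZ3 J ∧ ∀ t t' t'' : T,
            J ((iT t ⊗ₜ[k] iT t') ⊗ₜ[k] iT t'')
              = algebraMap k A
                  (Coalgebra.counit t * Coalgebra.counit t' * Coalgebra.counit t''))
    -- measuring coboundaries are sent to 3-coboundaries
    ∧ (∀ (f : (T ⊗[k] T) ⊗[k] N →ₗ[k] A) (J : (H ⊗[k] H) ⊗[k] H →ₗ[k] A),
        IsMeasB2 μ f → JOf iN iT f J → IsB3 J)
    -- compatibility with products (so that `j` is a group homomorphism)
    ∧ (∀ (f f' : (T ⊗[k] T) ⊗[k] N →ₗ[k] A) (J J' : (H ⊗[k] H) ⊗[k] H →ₗ[k] A),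
        JOf iN iT f J → JOf iN iT f' J' → JOf iN iT (conv f f') (conv J J')) := by
  have := hsmash.isCocomm hTcc hNcc
  refine ⟨fun f => ⟨_, hsmash.jOf_proj3 f⟩, fun f J hf hJ => ?_, fun f J hf hJ => ?_,
    fun f f' J J' hJ hJ' => ?_⟩
  · obtain rfl := hsmash.eq_comp_proj3 hJ
    refine ⟨hsmash.isZ3 hf, fun t t' t'' => ?_⟩
    simp [Algebra.algebraMap_eq_smul_one, hf.1.1.2, smul_smul, mul_comm, mul_left_comm]
  · obtain rfl := hsmash.eq_comp_proj3 hJ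
    exact hsmash.isB3 hf
  · rw [hsmash.eq_comp_proj3 hJ, hsmash.eq_comp_proj3 hJ', conv_comp_coalgHom]
    exact hsmash.jOf_proj3 _
end
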